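/- arXiv:1002.4739 — 2 statements merged into one kernel-verified Lean document; each statement's English description precedes it below -/
import Mathlib

section
/- Let G be a non-bipartite twisted net with n vertices and corners v₁, v₂, v₃, v₄. For 1 ≤ i < j ≤ 4 let m_{ij} be the number of perfect matchings of G \ {v_i, v_j}. Then the product of all six numbers m_{ij} is at least 2^(n/18 + 4/9); in particular every m_{ij} is at least one. -/
open SimpleGraph
open scoped Classical

universe u

variable {V : Type u}

/-- `M` is a perfect matching of `G`: a set of edges of `G` such that every
vertex is incident to exactly one edge of `M`. -/
def IsPM (G : SimpleGraph V) (M : Set (Sym2 V)) : Prop :=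
  M ⊆ G.edgeSet ∧ ∀ v : V, ∃! e, e ∈ M ∧ v ∈ e

/-- The edge-cut `E(A, Aᶜ)`: edges of `G` with one end in `A` and one end outside. -/
def cutEdges (G : SimpleGraph V) (A : Set V) : Set (Sym2 V) :=
  {e | e ∈ G.edgeSet ∧ ∃ x y, e = s(x, y) ∧ x ∈ A ∧ y ∉ A}

/-- The edge-cut `E(A, Aᶜ)` is cyclic: both sides induce a subgraph with a cycle. -/
def CyclicCut (G : SimpleGraph V) (A : Set V) : Prop :=
  ¬(G.induce A).IsAcyclic ∧ ¬(G.induce Aᶜ).IsAcyclic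

/-- `G` has no cyclic edge-cut of size less than `k`. -/
def CyclicallyEdgeConnected (G : SimpleGraph V) (k : ℕ) : Prop :=
  ∀ A : Set V, CyclicCut G A → k ≤ (cutEdges G A).ncard

/-- Every edge-cut of `G` has at least `k` edges. -/
def EdgeConnectedGe (G : SimpleGraph V) (k : ℕ) : Prop :=
  ∀ A : Set V, A.Nonempty → Aᶜ.Nonempty → k ≤ (cutEdges G A).ncard

/-- `G` is cubic: every vertex has degree three. -/
def CubicGraph (G : SimpleGraph V) : Prop :=
  ∀ v : V, (G.neighborSet v).ncard = 3

/-- `G` has no bridges. -/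
def Bridgeless (G : SimpleGraph V) : Prop :=
  ∀ e ∈ G.edgeSet, ¬G.IsBridge e

/-- `G` is matching-covered: connected and every edge lies in a perfect matching. -/
def MatchingCovered (G : SimpleGraph V) : Prop :=
  G.Connected ∧ ∀ e ∈ G.edgeSet, ∃ M, IsPM G M ∧ e ∈ M

/-- `M` is a matching of the subgraph of `G` induced on `A` which covers exactly the
vertices of `A \ X` (i.e. covers all vertices of `A` except those in `X`). -/
def IsNearPM (G : SimpleGraph V) (A X : Set V) (M : Set (Sym2 V)) : Prop :=
  (∀ e ∈ M, ∃ x y, e = s(x, y) ∧ G.Adj x y ∧ x ∈ A ∧ y ∈ A) ∧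
  (∀ w ∈ A \ X, ∃! e, e ∈ M ∧ w ∈ e) ∧
  (∀ w ∈ X, ∀ e ∈ M, w ∉ e)

/-- `IsTwistedNet G st c`: the subgraph of `G` induced on the vertex set `st` is a
twisted net with corner set `c`.  A 4-cycle is a twisted net whose corners are its
four vertices; and one may join a twisted net and a twisted net (multiplication), or
a twisted net and a single edge (incrementation), by two edges between corners. -/
inductive IsTwistedNet (G : SimpleGraph V) : Set V → Set V → Prop
  | cyc4 (a b c d : V) (hab : a ≠ b) (hac : a ≠ c) (had : a ≠ d)
      (hbc : b ≠ c) (hbd : b ≠ d) (hcd : c ≠ d)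
      (hadj : ∀ x ∈ ({a, b, c, d} : Set V), ∀ y ∈ ({a, b, c, d} : Set V),
        (G.Adj x y ↔ s(x, y) ∈ ({s(a, b), s(b, c), s(c, d), s(d, a)} : Set (Sym2 V)))) :
      IsTwistedNet G {a, b, c, d} {a, b, c, d}
  | incr (st c : Set V) (u u' v v' : V)
      (hprev : IsTwistedNet G st c)
      (hu : u ∈ c) (hu' : u' ∈ c) (huu' : u ≠ u')
      (hv : v ∉ st) (hv' : v' ∉ st) (hvv' : v ≠ v')
      (hvv'adj : G.Adj v v') (huv : G.Adj u v) (hu'v' : G.Adj u' v')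
      (hcross : ∀ x ∈ st, (G.Adj x v ↔ x = u) ∧ (G.Adj x v' ↔ x = u')) :
      IsTwistedNet G (st ∪ {v, v'}) ((c \ {u, u'}) ∪ {v, v'})
  | mult (st₁ c₁ st₂ c₂ : Set V) (u u' v v' : V)
      (h₁ : IsTwistedNet G st₁ c₁) (h₂ : IsTwistedNet G st₂ c₂)
      (hdisj : st₁ ∩ st₂ = ∅)
      (hu : u ∈ c₁) (hu' : u' ∈ c₁) (huu' : u ≠ u')
      (hv : v ∈ c₂) (hv' : v' ∈ c₂) (hvv' : v ≠ v')
      (huv : G.Adj u v) (hu'v' : G.Adj u' v')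
      (hcross : ∀ x ∈ st₁, ∀ y ∈ st₂,
        (G.Adj x y ↔ ((x = u ∧ y = v) ∨ (x = u' ∧ y = v')))) :
      IsTwistedNet G (st₁ ∪ st₂) ((c₁ \ {u, u'}) ∪ (c₂ \ {v, v'}))

/-- The set of (vertex sets of) semiblocks of `G`: inclusion-wise minimal sides of
2-edge-cuts. -/
def Semiblocks (G : SimpleGraph V) : Set (Set V) :=
  {A | A.Nonempty ∧ (cutEdges G A).ncard = 2 ∧
    ∀ A' ⊆ A, A'.Nonempty → (cutEdges G A').ncard = 2 → A' = A}

/-- The number of semiblocks of `G`; if `G` has no 2-edge-cut, `G` itself is its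
unique semiblock, so the number of semiblocks is `1` in this case. -/
noncomputable def numSemiblocks (G : SimpleGraph V) : ℕ :=
  max 1 (Semiblocks G).ncard

/-- The side `B` of a cyclic 4-edge-cut is solid if `G[B]` has no 2-edge-cut with at
least two vertices on each side. -/
def SolidSide (G : SimpleGraph V) (B : Set V) : Prop :=
  ¬∃ X ⊆ B, 2 ≤ X.ncard ∧ 2 ≤ (B \ X).ncard ∧
      ({e | e ∈ G.edgeSet ∧ ∃ x y, e = s(x, y) ∧ x ∈ X ∧ y ∈ B \ X}).ncard = 2

/-- The subgraph of `G` induced on `A` is a ladder (a `2 × k` grid) whose two ends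
(the edges both of whose end-vertices have degree two in the ladder) are `f₁` and `f₂`. -/
def IsLadder (G : SimpleGraph V) (A : Set V) (f₁ f₂ : Sym2 V) : Prop :=
  ∃ (k : ℕ) (x y : Fin (k + 1) → V),
    Function.Injective x ∧ Function.Injective y ∧ (∀ i j, x i ≠ y j) ∧
    A = Set.range x ∪ Set.range y ∧
    (∀ u ∈ A, ∀ v ∈ A, (G.Adj u v ↔
      ((∃ i, u = x i ∧ v = y i) ∨ (∃ i, u = y i ∧ v = x i) ∨
       (∃ i : Fin k, (u = x i.castSucc ∧ v = x i.succ) ∨ (u = x i.succ ∧ v = x i.castSucc) ∨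
         (u = y i.castSucc ∧ v = y i.succ) ∨ (u = y i.succ ∧ v = y i.castSucc))))) ∧
    f₁ = s(x 0, y 0) ∧ f₂ = s(x (Fin.last k), y (Fin.last k))

/-- The subgraph of `G` induced on `A` is a cycle of length four. -/
def Is4Cycle (G : SimpleGraph V) (A : Set V) : Prop :=
  ∃ a b c d : V, a ≠ b ∧ a ≠ c ∧ a ≠ d ∧ b ≠ c ∧ b ≠ d ∧ c ≠ d ∧
    A = {a, b, c, d} ∧
    G.Adj a b ∧ G.Adj b c ∧ G.Adj c d ∧ G.Adj d a ∧ ¬G.Adj a c ∧ ¬G.Adj b d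

/-- The graph `G_{(pq)}` obtained from `G[A]` by adding a new vertex (`Sum.inr 0`)
adjacent to `p` and `q`, a new vertex (`Sum.inr 1`) adjacent to `r` and `t`, and an
edge between the two new vertices. -/
def GExt (G : SimpleGraph V) (A : Set V) (p q r t : V) : SimpleGraph (↥A ⊕ Fin 2) :=
  SimpleGraph.fromRel (fun x y =>
    (∃ u v : A, x = Sum.inl u ∧ y = Sum.inl v ∧ G.Adj u v) ∨
    (∃ u : A, x = Sum.inr 0 ∧ y = Sum.inl u ∧ ((u : V) = p ∨ (u : V) = q)) ∨
    (∃ u : A, x = Sum.inr 1 ∧ y = Sum.inl u ∧ ((u : V) = r ∨ (u : V) = t)) ∨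
    (x = Sum.inr 0 ∧ y = Sum.inr 1))

/-- Perfect matching, as a finite edge set. -/
def IsPMF (G : SimpleGraph V) (M : Finset (Sym2 V)) : Prop :=
  (↑M : Set (Sym2 V)) ⊆ G.edgeSet ∧ ∀ v : V, ∃! e, e ∈ M ∧ v ∈ e

/-- `w` lies in the perfect matching polytope of `G`: it is a convex combination of
characteristic vectors of perfect matchings of `G`. -/
def InPMPolytope [Fintype V] [DecidableEq V] (G : SimpleGraph V) (w : Sym2 V → ℝ) : Prop :=
  ∃ μ : Finset (Sym2 V) → ℝ,
    (∀ M, 0 ≤ μ M) ∧ (∀ M, μ M ≠ 0 → IsPMF G M) ∧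
    (∑ M : Finset (Sym2 V), μ M) = 1 ∧
    ∀ e : Sym2 V, w e = ∑ M : Finset (Sym2 V), μ M * (if e ∈ M then 1 else 0)

/-- The numbers of matchings of a graph with four corners which miss exactly a given even
set of corners: `e` and `f` count those missing no corner and all corners, and `aᵢⱼ` those
missing the `i`-th and the `j`-th corner. -/
@[ext]
structure CornerCounts where
  e : ℕ
  a12 : ℕ
  a13 : ℕ
  a14 : ℕ
  a23 : ℕ
  a24 : ℕ
  a34 : ℕ
  f : ℕ

namespace CornerCounts

/-- Exchange the first two corners. -/
def swap12 (m : CornerCounts) : CornerCounts :=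
  ⟨m.e, m.a12, m.a23, m.a24, m.a13, m.a14, m.a34, m.f⟩

/-- Exchange the two middle corners. -/
def swap23 (m : CornerCounts) : CornerCounts :=
  ⟨m.e, m.a13, m.a12, m.a14, m.a23, m.a34, m.a24, m.f⟩

/-- Exchange the last two corners. -/
def swap34 (m : CornerCounts) : CornerCounts :=
  ⟨m.e, m.a12, m.a14, m.a13, m.a24, m.a23, m.a34, m.f⟩

/-- The counts after an incrementation at the first two corners. -/
def incr (m : CornerCounts) : CornerCounts :=
  ⟨m.e + m.a12, m.e, m.a13, m.a14, m.a23, m.a24, m.a34 + m.f, m.a34⟩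

/-- The counts after a multiplication which joins the first two corners of both factors. -/
def mult (m k : CornerCounts) : CornerCounts :=
  ⟨m.e * k.e + m.a12 * k.a12, m.a34 * k.e + m.f * k.a12,
    m.a13 * k.a13 + m.a23 * k.a23, m.a13 * k.a14 + m.a23 * k.a24,
    m.a14 * k.a13 + m.a24 * k.a23, m.a14 * k.a14 + m.a24 * k.a24,
    m.e * k.a34 + m.a12 * k.f, m.a34 * k.a34 + m.f * k.f⟩

/-- Among the four products belonging to the partitions of the corners into two even sets,
each is at most the sum of the other three. -/
structure Quad (m : CornerCounts) : Prop where
  hA : m.a12 * m.a34 ≤ m.a13 * m.a24 + m.a14 * m.a23 + m.e * m.f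
  hB : m.a13 * m.a24 ≤ m.a12 * m.a34 + m.a14 * m.a23 + m.e * m.f
  hC : m.a14 * m.a23 ≤ m.a12 * m.a34 + m.a13 * m.a24 + m.e * m.f
  hD : m.e * m.f ≤ m.a12 * m.a34 + m.a13 * m.a24 + m.a14 * m.a23

/-- The invariants of twisted nets on `n` vertices that are built in a non-bipartite way. -/
structure NonBip (n : ℕ) (m : CornerCounts) : Prop where
  quad : m.Quad
  e_ge : 2 ≤ m.e
  a12_pos : 1 ≤ m.a12
  a13_pos : 1 ≤ m.a13
  a14_pos : 1 ≤ m.a14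
  a23_pos : 1 ≤ m.a23
  a24_pos : 1 ≤ m.a24
  a34_pos : 1 ≤ m.a34
  prod_ge : 2 ≤ (m.a12 * m.a34) * ((m.a13 * m.a24) * (m.a14 * m.a23))
  e_le : m.e ≤ 3 * ((m.a12 * m.a34) * ((m.a13 * m.a24) * (m.a14 * m.a23)))
  growth : 2 ^ n ≤ 8 * ((m.a12 * m.a34) * ((m.a13 * m.a24) * (m.a14 * m.a23)) * m.e ^ 2)

/-- The invariants of bipartite twisted nets on `n` vertices whose first and third corner lie
in one colour class, and whose second and fourth corner lie in the other one. -/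
structure Bip (n : ℕ) (m : CornerCounts) : Prop where
  quad : m.Quad
  e_ge : 2 ≤ m.e
  a12_pos : 1 ≤ m.a12
  a13_eq : m.a13 = 0
  a14_pos : 1 ≤ m.a14
  a23_pos : 1 ≤ m.a23
  a24_eq : m.a24 = 0
  a34_pos : 1 ≤ m.a34
  f_pos : 1 ≤ m.f
  growth : 2 ^ n ≤ 4 * ((m.a12 * m.a34) * (m.a14 * m.a23) * m.e ^ 2)

theorem Quad.swap12 {m : CornerCounts} (h : m.Quad) : m.swap12.Quad := by
  obtain ⟨h1, h2, h3, h4⟩ := h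
  constructor <;> simp only [CornerCounts.swap12] <;> linarith

theorem Quad.swap23 {m : CornerCounts} (h : m.Quad) : m.swap23.Quad := by
  obtain ⟨h1, h2, h3, h4⟩ := h
  constructor <;> simp only [CornerCounts.swap23] <;> linarith

theorem Quad.swap34 {m : CornerCounts} (h : m.Quad) : m.swap34.Quad := by
  obtain ⟨h1, h2, h3, h4⟩ := h
  constructor <;> simp only [CornerCounts.swap34] <;> linarith

theorem Quad.incr {m : CornerCounts} (h : m.Quad) : m.incr.Quad := by
  obtain ⟨h1, h2, h3, h4⟩ := h
  constructor <;> simp only [CornerCounts.incr] <;> nlinarith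

theorem Quad.mult {m k : CornerCounts} (h : m.Quad) (h' : k.Quad) : (m.mult k).Quad := by
  obtain ⟨e, a12, a13, a14, a23, a24, a34, f⟩ := m
  obtain ⟨e', b12, b13, b14, b23, b24, b34, f'⟩ := k
  obtain ⟨h1, h2, h3, h4⟩ := h
  obtain ⟨k1, k2, k3, k4⟩ := h'
  simp only at h1 h2 h3 h4 k1 k2 k3 k4
  have key : ∀ x y x' y' : ℤ, |x| ≤ y → |x'| ≤ y' → |x * x'| ≤ y * y' := by
    intro x y x' y' hx hx'
    rw [abs_mul]
    exact mul_le_mul hx hx' (abs_nonneg _) ((abs_nonneg _).trans hx)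
  zify at h1 h2 h3 h4 k1 k2 k3 k4
  have p1 := abs_le.1 <| key (a12 * a34 - e * f) (a13 * a24 + a14 * a23)
    (b12 * b34 - e' * f') (b13 * b24 + b14 * b23)
    (abs_le.2 ⟨by linarith, by linarith⟩) (abs_le.2 ⟨by linarith, by linarith⟩)
  have p2 := abs_le.1 <| key (a13 * a24 - a14 * a23) (a12 * a34 + e * f)
    (b13 * b24 - b14 * b23) (b12 * b34 + e' * f')
    (abs_le.2 ⟨by linarith, by linarith⟩) (abs_le.2 ⟨by linarith, by linarith⟩)
  have q1 : (0 : ℤ) ≤ e * a34 * (e' * b34) := by positivity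
  have q2 : (0 : ℤ) ≤ a12 * f * (b12 * f') := by positivity
  have q3 : (0 : ℤ) ≤ a13 * a14 * (b13 * b14) := by positivity
  have q4 : (0 : ℤ) ≤ a23 * a24 * (b23 * b24) := by positivity
  constructor <;> simp only [CornerCounts.mult] <;> zify <;>
    linarith [p1.1, p1.2, p2.1, p2.2]

theorem NonBip.swap12 {n : ℕ} {m : CornerCounts} (h : m.NonBip n) : m.swap12.NonBip n := by
  obtain ⟨h0, h1, h2, h3, h4, h5, h6, h7, h8, h9, h10⟩ := h
  refine ⟨h0.swap12, h1, h2, h5, h6, h3, h4, h7, ?_, ?_, ?_⟩ <;>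
    simp only [CornerCounts.swap12] <;> linarith

theorem NonBip.swap23 {n : ℕ} {m : CornerCounts} (h : m.NonBip n) : m.swap23.NonBip n := by
  obtain ⟨h0, h1, h2, h3, h4, h5, h6, h7, h8, h9, h10⟩ := h
  refine ⟨h0.swap23, h1, h3, h2, h4, h5, h7, h6, ?_, ?_, ?_⟩ <;>
    simp only [CornerCounts.swap23] <;> linarith

theorem NonBip.swap34 {n : ℕ} {m : CornerCounts} (h : m.NonBip n) : m.swap34.NonBip n := by
  obtain ⟨h0, h1, h2, h3, h4, h5, h6, h7, h8, h9, h10⟩ := h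
  refine ⟨h0.swap34, h1, h2, h4, h3, h6, h5, h7, ?_, ?_, ?_⟩ <;>
    simp only [CornerCounts.swap34] <;> linarith

/-- Exchange the two corners of the first colour class. -/
theorem Bip.swap13 {n : ℕ} {m : CornerCounts} (h : m.Bip n) :
    m.swap12.swap23.swap12.Bip n := by
  obtain ⟨h0, h1, h2, h3, h4, h5, h6, h7, h8, h9⟩ := h
  refine ⟨h0.swap12.swap23.swap12, h1, h5, h3, h7, h2, h6, h4, h8, ?_⟩
  simp only [CornerCounts.swap12, CornerCounts.swap23]
  linarith

/-- Exchange the two corners of the second colour class. -/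
theorem Bip.swap24 {n : ℕ} {m : CornerCounts} (h : m.Bip n) :
    m.swap23.swap34.swap23.Bip n := by
  obtain ⟨h0, h1, h2, h3, h4, h5, h6, h7, h8, h9⟩ := h
  refine ⟨h0.swap23.swap34.swap23, h1, h4, h3, h2, h7, h6, h5, h8, ?_⟩
  simp only [CornerCounts.swap34, CornerCounts.swap23]
  linarith

/-- Exchange the two colour classes. -/
theorem Bip.swap_colors {n : ℕ} {m : CornerCounts} (h : m.Bip n) :
    m.swap12.swap34.Bip n := by
  obtain ⟨h0, h1, h2, h3, h4, h5, h6, h7, h8, h9⟩ := h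
  refine ⟨h0.swap12.swap34, h1, h2, h6, h5, h4, h3, h7, h8, ?_⟩
  simp only [CornerCounts.swap34, CornerCounts.swap12]
  linarith

theorem two_le_mul_mul {a b c d x y : ℕ} (ha : 2 ≤ a) (hb : 1 ≤ b) (hc : 1 ≤ c)
    (hd : 1 ≤ d) (hx : 1 ≤ x) (hy : 1 ≤ y) : 2 ≤ (a * b) * ((c * d) * (x * y)) :=
  calc 2 = 2 * 1 * ((1 * 1) * (1 * 1)) := by ring
    _ ≤ _ := by gcongr

theorem add_add_le_three_mul {a b c : ℕ} (ha : 1 ≤ a) (hb : 1 ≤ b) (hc : 1 ≤ c) :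
    a + b + c ≤ 3 * (a * (b * c)) := by
  have h1 : a ≤ a * (b * c) := Nat.le_mul_of_pos_right _ (by positivity)
  have h2 : b ≤ a * (b * c) := by
    calc b ≤ b * c := Nat.le_mul_of_pos_right _ hc
      _ ≤ _ := Nat.le_mul_of_pos_left _ ha
  have h3 : c ≤ a * (b * c) := by
    calc c ≤ b * c := Nat.le_mul_of_pos_left _ hb
      _ ≤ _ := Nat.le_mul_of_pos_left _ ha
  omega

theorem Bip.incr {n : ℕ} {m : CornerCounts} (h : m.Bip n) : m.incr.Bip (n + 2) := by
  obtain ⟨e, a12, a13, a14, a23, a24, a34, f⟩ := m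
  obtain ⟨h0, h1, h2, h3, h4, h5, h6, h7, h8, h9⟩ := h
  refine ⟨h0.incr, ?_, ?_, h3, h4, h5, h6, ?_, h7, ?_⟩ <;>
    simp only [CornerCounts.incr] at * <;> try omega
  rw [pow_add]
  have key : a12 * e ^ 2 * 4 ≤ e * (e + a12) ^ 2 := by
    zify
    nlinarith [mul_nonneg (Int.natCast_nonneg e) (sq_nonneg ((e : ℤ) - a12))]
  calc 2 ^ n * 2 ^ 2 ≤ 4 * (a12 * a34 * (a14 * a23) * e ^ 2) * 2 ^ 2 := by gcongr
    _ = 4 * (a34 * (a14 * a23) * (a12 * e ^ 2 * 4)) := by ring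
    _ ≤ 4 * ((a34 + f) * (a14 * a23) * (e * (e + a12) ^ 2)) := by gcongr; omega
    _ = _ := by ring

theorem NonBip.incr {n : ℕ} {m : CornerCounts} (h : m.NonBip n) : m.incr.NonBip (n + 2) := by
  obtain ⟨e, a12, a13, a14, a23, a24, a34, f⟩ := m
  obtain ⟨h0, h1, h2, h3, h4, h5, h6, h7, h8, h9, h10⟩ := h
  have hA := h0.hA
  refine ⟨h0.incr, ?_, ?_, h3, h4, h5, h6, ?_, ?_, ?_, ?_⟩ <;>
    simp only [CornerCounts.incr] at * <;> try omega
  · calc 2 ≤ e := h1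
      _ = e * 1 * ((1 * 1) * (1 * 1)) := by ring
      _ ≤ _ := by gcongr; omega
  · have hB : 1 ≤ a13 * a24 := Nat.mul_pos h3 h6
    have hC : 1 ≤ a14 * a23 := Nat.mul_pos h4 h5
    generalize a13 * a24 = B at *
    generalize a14 * a23 = C at *
    have h12 : a12 ≤ a12 * a34 := Nat.le_mul_of_pos_right _ h7
    have hBC : 1 ≤ B * C := Nat.mul_pos hB hC
    have h3' := add_add_le_three_mul (le_refl 1) hB hC
    have e1 : e ≤ e * (B * C) := Nat.le_mul_of_pos_right _ hBC
    have e2 : e * f ≤ e * f * (B * C) := Nat.le_mul_of_pos_right _ hBC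
    have e3 : 2 * (B * C) ≤ e * (B * C) := Nat.mul_le_mul_right _ h1
    have e4 : e * 1 * (B * C) ≤ e * a34 * (B * C) := by gcongr
    have hBC' : B + C ≤ 2 * (B * C) := by nlinarith
    nlinarith
  · rw [pow_add]
    have key : a12 * e ^ 2 * 4 ≤ e * (e + a12) ^ 2 := by
      zify
      nlinarith [mul_nonneg (Int.natCast_nonneg e) (sq_nonneg ((e : ℤ) - a12))]
    calc 2 ^ n * 2 ^ 2 ≤ 8 * (a12 * a34 * (a13 * a24 * (a14 * a23)) * e ^ 2) * 2 ^ 2 := by gcongr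
      _ = 8 * (a34 * (a13 * a24 * (a14 * a23)) * (a12 * e ^ 2 * 4)) := by ring
      _ ≤ 8 * ((a34 + f) * (a13 * a24 * (a14 * a23)) * (e * (e + a12) ^ 2)) := by gcongr; omega
      _ = _ := by ring

theorem Bip.incr_same {n : ℕ} {m : CornerCounts} (h : m.Bip n) :
    m.swap23.incr.NonBip (n + 2) := by
  obtain ⟨e, a12, a13, a14, a23, a24, a34, f⟩ := m
  obtain ⟨h0, h1, h2, h3, h4, h5, h6, h7, h8, h9⟩ := h
  refine ⟨h0.swap23.incr, ?_, ?_, h2, h4, h5, h7, ?_, ?_, ?_, ?_⟩ <;>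
    simp only [CornerCounts.incr, CornerCounts.swap23] at * <;> subst h3 h6 <;>
    (try simp only [zero_add, add_zero] at *) <;> try omega
  · calc 2 ≤ e := h1
      _ = e * 1 * ((1 * 1) * (1 * 1)) := by ring
      _ ≤ _ := by gcongr
  · calc e ≤ 3 * e := by omega
      _ = 3 * (e * 1 * ((1 * 1) * (1 * 1))) := by ring
      _ ≤ _ := by gcongr
  · rw [pow_add]
    calc 2 ^ n * 2 ^ 2 ≤ 4 * (a12 * a34 * (a14 * a23) * e ^ 2) * 2 ^ 2 := by gcongr
      _ = 8 * (2 * 1 * (a12 * a34 * (a14 * a23)) * e ^ 2) := by ring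
      _ ≤ _ := by gcongr

theorem four_mul_le_mul_sq (e e' a b x y z w : ℕ) :
    4 * ((a * x) * (b * y) * (e ^ 2 * e' ^ 2)) ≤
      ((x * e' + z * b) * (e * y + a * w)) * (e * e' + a * b) ^ 2 := by
  have h : 4 * ((e * e') * (a * b)) ≤ (e * e' + a * b) ^ 2 := by
    zify
    nlinarith [sq_nonneg ((e * e' : ℤ) - a * b)]
  calc 4 * ((a * x) * (b * y) * (e ^ 2 * e' ^ 2))
      = (x * e') * (e * y) * (4 * ((e * e') * (a * b))) := by ring
    _ ≤ _ := by gcongr <;> omega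

theorem four_mul_le_cross (a13 a14 a23 a24 b13 b14 b23 b24 : ℕ) :
    4 * ((a13 * a24) * (a14 * a23) * ((b13 * b24) * (b14 * b23))) ≤
      ((a13 * b13 + a23 * b23) * (a14 * b14 + a24 * b24)) *
        ((a13 * b14 + a23 * b24) * (a14 * b13 + a24 * b23)) := by
  have hB : (a13 * a24) * (b13 * b24) + (a14 * a23) * (b14 * b23) ≤
      (a13 * b13 + a23 * b23) * (a14 * b14 + a24 * b24) := by
    nlinarith [Nat.zero_le (a13 * a14 * (b13 * b14)), Nat.zero_le (a23 * a24 * (b23 * b24))]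
  have hC : (a13 * a24) * (b14 * b23) + (a14 * a23) * (b13 * b24) ≤
      (a13 * b14 + a23 * b24) * (a14 * b13 + a24 * b23) := by
    nlinarith [Nat.zero_le (a13 * a14 * (b13 * b14)), Nat.zero_le (a23 * a24 * (b23 * b24))]
  refine le_trans ?_ (Nat.mul_le_mul hB hC)
  generalize a13 * a24 = B
  generalize a14 * a23 = C
  generalize b13 * b24 = B'
  generalize b14 * b23 = C'
  zify
  nlinarith [mul_nonneg (mul_nonneg (Int.natCast_nonneg B') (Int.natCast_nonneg C'))
      (sq_nonneg ((B : ℤ) - C)),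
    mul_nonneg (mul_nonneg (Int.natCast_nonneg B) (Int.natCast_nonneg C))
      (sq_nonneg ((B' : ℤ) - C'))]

theorem Quad.e_le {m : CornerCounts} (h : m.Quad) (h1 : 1 ≤ m.a12) (h2 : 1 ≤ m.a13)
    (h3 : 1 ≤ m.a14) (h4 : 1 ≤ m.a23) (h5 : 1 ≤ m.a24) (h6 : 1 ≤ m.a34) (hf : 1 ≤ m.f) :
    m.e ≤ 3 * ((m.a12 * m.a34) * ((m.a13 * m.a24) * (m.a14 * m.a23))) :=
  calc m.e ≤ m.e * m.f := Nat.le_mul_of_pos_right _ hf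
    _ ≤ _ := h.hD
    _ ≤ _ := add_add_le_three_mul (Nat.mul_pos h1 h6) (Nat.mul_pos h2 h5) (Nat.mul_pos h3 h4)

theorem NonBip.mult {n n' : ℕ} {m k : CornerCounts} (h : m.NonBip n) (h' : k.NonBip n') :
    (m.mult k).NonBip (n + n') := by
  have hq := h.quad.mult h'.quad
  obtain ⟨e, a12, a13, a14, a23, a24, a34, f⟩ := m
  obtain ⟨e', b12, b13, b14, b23, b24, b34, f'⟩ := k
  obtain ⟨-, h1, h2, h3, h4, h5, h6, h7, -, -, h10⟩ := h
  obtain ⟨-, k1, k2, k3, k4, k5, k6, k7, -, -, k10⟩ := h'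
  have he := hq.e_le
  simp only [CornerCounts.mult] at *
  have p1 : 2 ≤ a34 * e' := by nlinarith
  have p2 : 2 ≤ e * b34 := by nlinarith
  have p3 := Nat.mul_pos h3 k3
  have p4 := Nat.mul_pos h3 k4
  have p5 := Nat.mul_pos h4 k3
  have p6 := Nat.mul_pos h4 k4
  have p7 := Nat.mul_pos h7 k7
  have p8 : 1 ≤ e * e' := by nlinarith
  have p9 : 2 ≤ e * e' := by nlinarith
  refine ⟨hq, by simp only; omega, by simp only; omega, by simp only; omega,
    by simp only; omega, by simp only; omega, by simp only; omega, by simp only; omega, ?_,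
    he (by omega) (by omega) (by omega) (by omega) (by omega) (by omega) (by omega), ?_⟩
  · exact two_le_mul_mul (by simp only; omega) (by simp only; omega) (by simp only; omega)
      (by simp only; omega) (by simp only; omega) (by simp only; omega)
  · have := four_mul_le_mul_sq e e' a12 b12 a34 b34 f f'
    have := four_mul_le_cross a13 a14 a23 a24 b13 b14 b23 b24
    rw [pow_add]
    calc 2 ^ n * 2 ^ n' ≤ 8 * (a12 * a34 * (a13 * a24 * (a14 * a23)) * e ^ 2) *
          (8 * (b12 * b34 * (b13 * b24 * (b14 * b23)) * e' ^ 2)) := by gcongr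
      _ = 4 * (4 * ((a12 * a34) * (b12 * b34) * (e ^ 2 * e' ^ 2)) *
        (4 * ((a13 * a24) * (a14 * a23) * ((b13 * b24) * (b14 * b23))))) := by ring
      _ ≤ 8 * (((a34 * e' + f * b12) * (e * b34 + a12 * f')) * (e * e' + a12 * b12) ^ 2 *
        (((a13 * b13 + a23 * b23) * (a14 * b14 + a24 * b24)) *
        ((a13 * b14 + a23 * b24) * (a14 * b13 + a24 * b23)))) := by gcongr; omega
      _ = _ := by ring

theorem NonBip.mult_bip {n n' : ℕ} {m k : CornerCounts} (h : m.NonBip n) (h' : k.Bip n') :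
    (m.mult k).NonBip (n + n') := by
  have hq := h.quad.mult h'.quad
  obtain ⟨e, a12, a13, a14, a23, a24, a34, f⟩ := m
  obtain ⟨e', b12, b13, b14, b23, b24, b34, f'⟩ := k
  obtain ⟨-, h1, h2, h3, h4, h5, h6, h7, -, -, h10⟩ := h
  obtain ⟨-, k1, k2, k3, k4, k5, k6, k7, k8, k9⟩ := h'
  have he := hq.e_le
  simp only at k3 k6
  subst k3 k6
  simp only [CornerCounts.mult, mul_zero, add_zero, zero_add] at *
  have p1 : 2 ≤ a34 * e' := by nlinarith
  have p2 : 2 ≤ e * b34 := by nlinarith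
  have p3 := Nat.mul_pos h3 k4
  have p4 := Nat.mul_pos h5 k5
  have p5 := Nat.mul_pos h4 k4
  have p6 := Nat.mul_pos h6 k5
  have p7 := Nat.mul_pos h7 k7
  have p9 : 2 ≤ e * e' := by nlinarith
  refine ⟨hq, by simp only; omega, by simp only; omega, by simp only; omega,
    by simp only; omega, by simp only; omega, by simp only; omega, by simp only; omega, ?_,
    he (by omega) (by omega) (by omega) (by omega) (by omega) (by omega) (by omega), ?_⟩
  · exact two_le_mul_mul (by simp only; omega) (by simp only; omega) (by simp only; omega)
      (by simp only; omega) (by simp only; omega) (by simp only; omega)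
  · have := four_mul_le_mul_sq e e' a12 b12 a34 b34 f f'
    have hC : 1 ≤ b14 * b23 := Nat.mul_pos k4 k5
    rw [pow_add]
    calc 2 ^ n * 2 ^ n' ≤ 8 * (a12 * a34 * (a13 * a24 * (a14 * a23)) * e ^ 2) *
          (4 * (b12 * b34 * (b14 * b23) * e' ^ 2)) := by gcongr
      _ = 8 * (4 * ((a12 * a34) * (b12 * b34) * (e ^ 2 * e' ^ 2)) *
        ((a13 * a24) * (a14 * a23) * (b14 * b23 * 1))) := by ring
      _ ≤ 8 * (((a34 * e' + f * b12) * (e * b34 + a12 * f')) * (e * e' + a12 * b12) ^ 2 *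
        ((a13 * a24) * (a14 * a23) * (b14 * b23 * (b14 * b23)))) := by gcongr
      _ = _ := by ring

theorem NonBip.mult_bip_same {n n' : ℕ} {m k : CornerCounts} (h : m.NonBip n)
    (h' : k.Bip n') : (m.mult k.swap23).NonBip (n + n') := by
  have hq := h.quad.mult h'.quad.swap23
  obtain ⟨e, a12, a13, a14, a23, a24, a34, f⟩ := m
  obtain ⟨e', b12, b13, b14, b23, b24, b34, f'⟩ := k
  obtain ⟨-, h1, h2, h3, h4, h5, h6, h7, -, h9, h10⟩ := h
  obtain ⟨-, k1, k2, k3, k4, k5, k6, k7, k8, k9⟩ := h'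
  simp only at k3 k6
  subst k3 k6
  simp only [CornerCounts.mult, CornerCounts.swap23, mul_zero, add_zero, zero_add] at *
  have p1 : 2 ≤ a34 * e' := by nlinarith
  have p2 : 1 ≤ a12 * f' := Nat.mul_pos h2 k8
  have p3 := Nat.mul_pos h3 k4
  have p4 := Nat.mul_pos h3 k2
  have p5 := Nat.mul_pos h4 k4
  have p6 := Nat.mul_pos h4 k2
  have p9 : 2 ≤ e * e' := by nlinarith
  have hcross := four_mul_le_cross a13 a14 a23 a24 b12 b14 b23 b34
  refine ⟨hq, by simp only; omega, by simp only; omega, by simp only; omega,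
    by simp only; omega, by simp only; omega, by simp only; omega, by simp only; omega, ?_,
    ?_, ?_⟩
  · exact two_le_mul_mul (by simp only; omega) (by simp only; omega) (by simp only; omega)
      (by simp only; omega) (by simp only; omega) (by simp only; omega)
  · calc e * e' ≤ 3 * (a12 * a34 * (a13 * a24 * (a14 * a23))) * e' := by gcongr
      _ = 3 * (a34 * e' * (a12 * 1) * (1 * (a13 * a24 * (a14 * a23) * ((1 * 1) * (1 * 1))))) := by
        ring
      _ ≤ 3 * (a34 * e' * (a12 * f') * (4 * ((a13 * a24) * (a14 * a23) *
          ((b12 * b34) * (b14 * b23))))) := by gcongr; omega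
      _ ≤ _ := by gcongr
  · rw [pow_add]
    calc 2 ^ n * 2 ^ n' ≤ 8 * (a12 * a34 * (a13 * a24 * (a14 * a23)) * e ^ 2) *
          (4 * (b12 * b34 * (b14 * b23) * e' ^ 2)) := by gcongr
      _ = 8 * ((a34 * 1) * (a12 * 1) * (e * e') ^ 2 *
        (4 * ((a13 * a24) * (a14 * a23) * ((b12 * b34) * (b14 * b23))))) := by ring
      _ ≤ 8 * ((a34 * e') * (a12 * f') * (e * e') ^ 2 *
          (((a13 * b12 + a23 * b23) * (a14 * b14 + a24 * b34)) *
        ((a13 * b14 + a23 * b34) * (a14 * b12 + a24 * b23)))) := by gcongr; omega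
      _ = _ := by ring

theorem Bip.mult_same {n n' : ℕ} {m k : CornerCounts} (h : m.Bip n)
    (h' : k.Bip n') : (m.mult k.swap23).NonBip (n + n') := by
  have hq := h.quad.mult h'.quad.swap23
  obtain ⟨e, a12, a13, a14, a23, a24, a34, f⟩ := m
  obtain ⟨e', b12, b13, b14, b23, b24, b34, f'⟩ := k
  obtain ⟨-, h1, h2, h3, h4, h5, h6, h7, h8, h9⟩ := h
  obtain ⟨-, k1, k2, k3, k4, k5, k6, k7, k8, k9⟩ := h'
  have he := hq.e_le
  simp only at h3 h6 k3 k6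
  subst h3 h6 k3 k6
  simp only [CornerCounts.mult, CornerCounts.swap23, mul_zero, zero_mul, add_zero,
    zero_add] at *
  have p1 : 2 ≤ a34 * e' := by nlinarith
  have p2 : 1 ≤ a12 * f' := Nat.mul_pos h2 k8
  have p3 := Nat.mul_pos h5 k5
  have p4 := Nat.mul_pos h5 k7
  have p5 := Nat.mul_pos h4 k4
  have p6 := Nat.mul_pos h4 k2
  have p7 := Nat.mul_pos h8 k8
  have p9 : 2 ≤ e * e' := by nlinarith
  refine ⟨hq, by simp only; omega, by simp only; omega, by simp only; omega,
    by simp only; omega, by simp only; omega, by simp only; omega, by simp only; omega, ?_,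
    he (by omega) (by omega) (by omega) (by omega) (by omega) (by omega) (by omega), ?_⟩
  · exact two_le_mul_mul (by simp only; omega) (by simp only; omega) (by simp only; omega)
      (by simp only; omega) (by simp only; omega) (by simp only; omega)
  · have hC : 1 ≤ a14 * a23 := Nat.mul_pos h4 h5
    rw [pow_add]
    calc 2 ^ n * 2 ^ n' ≤ 4 * (a12 * a34 * (a14 * a23) * e ^ 2) *
          (4 * (b12 * b34 * (b14 * b23) * e' ^ 2)) := by gcongr
      _ = 8 * ((a34 * 2) * (a12 * 1) * (e * e') ^ 2 *
        (a14 * a23 * 1 * ((b12 * b34) * (b14 * b23)))) := by ring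
      _ ≤ 8 * ((a34 * e') * (a12 * f') * (e * e') ^ 2 *
        (a14 * a23 * (a14 * a23) * ((b12 * b34) * (b14 * b23)))) := by gcongr
      _ = _ := by ring

theorem Bip.mult {n n' : ℕ} {m k : CornerCounts} (h : m.Bip n) (h' : k.Bip n') :
    (m.mult k).swap34.Bip (n + n') := by
  have hq := (h.quad.mult h'.quad).swap34
  obtain ⟨e, a12, a13, a14, a23, a24, a34, f⟩ := m
  obtain ⟨e', b12, b13, b14, b23, b24, b34, f'⟩ := k
  obtain ⟨-, h1, h2, h3, h4, h5, h6, h7, h8, h9⟩ := h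
  obtain ⟨-, k1, k2, k3, k4, k5, k6, k7, k8, k9⟩ := h'
  simp only at h3 h6 k3 k6
  subst h3 h6 k3 k6
  simp only [CornerCounts.mult, CornerCounts.swap34, mul_zero, zero_mul, add_zero,
    zero_add] at *
  have p1 : 2 ≤ a34 * e' := by nlinarith
  have p2 : 2 ≤ e * b34 := by nlinarith
  have p3 := Nat.mul_pos h4 k4
  have p4 := Nat.mul_pos h5 k5
  have p7 := Nat.mul_pos h8 k8
  have p9 : 2 ≤ e * e' := by nlinarith
  refine ⟨hq, by simp only; omega, by simp only; omega, rfl,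
    by simp only; omega, by simp only; omega, rfl, by simp only; omega, by simp only; omega, ?_⟩
  have := four_mul_le_mul_sq e e' a12 b12 a34 b34 f f'
  rw [pow_add]
  calc 2 ^ n * 2 ^ n' ≤ 4 * (a12 * a34 * (a14 * a23) * e ^ 2) *
        (4 * (b12 * b34 * (b14 * b23) * e' ^ 2)) := by gcongr
    _ = 4 * (4 * ((a12 * a34) * (b12 * b34) * (e ^ 2 * e' ^ 2)) *
      ((a14 * a23) * (b14 * b23))) := by ring
    _ ≤ 4 * (((a34 * e' + f * b12) * (e * b34 + a12 * f')) * (e * e' + a12 * b12) ^ 2 *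
      ((a14 * a23) * (b14 * b23))) := by gcongr
    _ = _ := by ring

theorem Bip.same_mult_same {n n' : ℕ} {m k : CornerCounts} (h : m.Bip n) (h' : k.Bip n') :
    (m.swap23.mult k.swap23).swap23.Bip (n + n') := by
  have hq := (h.quad.swap23.mult h'.quad.swap23).swap23
  obtain ⟨e, a12, a13, a14, a23, a24, a34, f⟩ := m
  obtain ⟨e', b12, b13, b14, b23, b24, b34, f'⟩ := k
  obtain ⟨-, h1, h2, h3, h4, h5, h6, h7, h8, h9⟩ := h
  obtain ⟨-, k1, k2, k3, k4, k5, k6, k7, k8, k9⟩ := h'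
  simp only at h3 h6 k3 k6
  subst h3 h6 k3 k6
  simp only [CornerCounts.mult, CornerCounts.swap23, mul_zero, zero_mul, add_zero,
    zero_add] at *
  have p3 := Nat.mul_pos h4 k4
  have p4 := Nat.mul_pos h4 k2
  have p5 := Nat.mul_pos h2 k2
  have p6 := Nat.mul_pos h2 k4
  have p7 := Nat.mul_pos h8 k8
  have p9 : 2 ≤ e * e' := by nlinarith
  refine ⟨hq, by simp only; omega, by simp only; omega, rfl,
    by simp only; omega, by simp only; omega, rfl, by simp only; omega, by simp only; omega, ?_⟩
  have := four_mul_le_cross a12 a14 a23 a34 b12 b14 b23 b34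
  rw [pow_add]
  calc 2 ^ n * 2 ^ n' ≤ 4 * (a12 * a34 * (a14 * a23) * e ^ 2) *
        (4 * (b12 * b34 * (b14 * b23) * e' ^ 2)) := by gcongr
    _ = 4 * (4 * ((a12 * a34) * (a14 * a23) * ((b12 * b34) * (b14 * b23))) *
        (e * e') ^ 2) := by ring
    _ ≤ _ := by gcongr

/-- The bound in terms of the number of vertices which the invariants entail. -/
theorem NonBip.two_rpow_le {n : ℕ} {m : CornerCounts} (h : m.NonBip n) :
    (2 : ℝ) ^ ((n : ℝ) / 18 + 4 / 9) ≤
      ((m.a12 * m.a34) * ((m.a13 * m.a24) * (m.a14 * m.a23)) : ℕ) := by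
  have h2 := h.prod_ge
  have h3 := h.e_le
  have h4 := h.growth
  generalize (m.a12 * m.a34) * ((m.a13 * m.a24) * (m.a14 * m.a23)) = p at *
  obtain hn | hn := le_or_gt n 10
  · calc (2 : ℝ) ^ ((n : ℝ) / 18 + 4 / 9) ≤ 2 ^ (1 : ℝ) := by
          apply Real.rpow_le_rpow_of_exponent_le one_le_two
          have : (n : ℝ) ≤ 10 := by exact_mod_cast hn
          linarith
      _ ≤ p := by rw [Real.rpow_one]; exact_mod_cast h2
  · have h5 : 2 ^ n ≤ 72 * p ^ 3 := by
      calc 2 ^ n ≤ 8 * (p * m.e ^ 2) := h4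
        _ ≤ 8 * (p * (3 * p) ^ 2) := by gcongr
        _ = _ := by ring
    have h6 : (2 : ℝ) ^ n ≤ 72 * (p : ℝ) ^ 3 := by exact_mod_cast h5
    have hn' : (11 : ℝ) ≤ n := by exact_mod_cast hn
    have hp : (0 : ℝ) < p := by exact_mod_cast (by omega : 0 < p)
    -- compare sixth powers, since `72 ^ 2 ≤ 2 ^ 13`
    refine le_of_pow_le_pow_left₀ (n := 6) (by norm_num) hp.le ?_
    rw [← Real.rpow_natCast, ← Real.rpow_mul (by norm_num)]
    have h7 : ((2 : ℝ) ^ n) ^ 2 ≤ 2 ^ 13 * (p : ℝ) ^ 6 := by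
      calc ((2 : ℝ) ^ n) ^ 2 ≤ (72 * (p : ℝ) ^ 3) ^ 2 := by gcongr
        _ = 72 ^ 2 * (p : ℝ) ^ 6 := by ring
        _ ≤ _ := by gcongr; norm_num
    have h8 : (2 : ℝ) ^ (13 : ℕ) * 2 ^ (((n : ℝ) / 18 + 4 / 9) * ((6 : ℕ) : ℝ)) ≤
        ((2 : ℝ) ^ n) ^ 2 := by
      rw [← pow_mul, ← Real.rpow_natCast, ← Real.rpow_natCast, ← Real.rpow_add (by norm_num)]
      apply Real.rpow_le_rpow_of_exponent_le one_le_two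
      push_cast
      linarith
    exact le_of_mul_le_mul_left (h8.trans h7) (by positivity)

end CornerCounts

/-- `M` is a perfect matching of the subgraph of `G` induced on `S`. -/
def IsPMOn (G : SimpleGraph V) (S : Set V) (M : Set (Sym2 V)) : Prop :=
  (∀ e ∈ M, e ∈ G.edgeSet ∧ ∀ x ∈ e, x ∈ S) ∧ ∀ w ∈ S, ∃! e, e ∈ M ∧ w ∈ e

/-- The number of perfect matchings of the subgraph of `G` induced on `S`. -/
noncomputable def pmCount (G : SimpleGraph V) (S : Set V) : ℕ :=
  {M | IsPMOn G S M}.ncard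

theorem isNearPM_univ_iff {G : SimpleGraph V} {X : Set V} {M : Set (Sym2 V)} :
    IsNearPM G Set.univ X M ↔ IsPMOn G (Set.univ \ X) M := by
  constructor
  · rintro ⟨h1, h2, h3⟩
    refine ⟨fun e he => ?_, h2⟩
    obtain ⟨x, y, rfl, hxy, -, -⟩ := h1 e he
    exact ⟨hxy, fun z hz => ⟨trivial, fun hzX => h3 z hzX _ he hz⟩⟩
  · rintro ⟨h1, h2⟩
    refine ⟨fun e he => ?_, h2, fun w hw e he hwe => ((h1 e he).2 w hwe).2 hw⟩
    induction e with
    | h x y => exact ⟨x, y, rfl, (h1 _ he).1, trivial, trivial⟩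

theorem ncard_isNearPM_univ (G : SimpleGraph V) (X : Set V) :
    {M : Set (Sym2 V) | IsNearPM G Set.univ X M}.ncard = pmCount G (Set.univ \ X) := by
  simp only [isNearPM_univ_iff, pmCount]

theorem pmCount_congr {G H : SimpleGraph V} {S : Set V}
    (h : ∀ x ∈ S, ∀ y ∈ S, (G.Adj x y ↔ H.Adj x y)) : pmCount G S = pmCount H S := by
  have key : ∀ e : Sym2 V, (e ∈ G.edgeSet ∧ ∀ x ∈ e, x ∈ S) ↔
      (e ∈ H.edgeSet ∧ ∀ x ∈ e, x ∈ S) := by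
    intro e
    induction e with
    | h x y =>
      simp only [SimpleGraph.mem_edgeSet, Sym2.mem_iff, forall_eq_or_imp, forall_eq]
      constructor <;> rintro ⟨h1, h2, h3⟩
      · exact ⟨(h x h2 y h3).1 h1, h2, h3⟩
      · exact ⟨(h x h2 y h3).2 h1, h2, h3⟩
  simp only [pmCount, IsPMOn, key]

theorem IsPMOn.insert {G : SimpleGraph V} {S : Set V} {u v : V} {M : Set (Sym2 V)}
    (h : IsPMOn G (S \ {u, v}) M) (huv : G.Adj u v) (hu : u ∈ S) (hv : v ∈ S) :
    IsPMOn G S (insert s(u, v) M) := by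
  refine ⟨?_, fun w hw => ?_⟩
  · rintro e (rfl | he)
    · exact ⟨huv, by simp [hu, hv]⟩
    · exact ⟨(h.1 e he).1, fun x hx => ((h.1 e he).2 x hx).1⟩
  · by_cases hwuv : w ∈ ({u, v} : Set V)
    · refine ⟨s(u, v), ⟨Or.inl rfl, by simpa using hwuv⟩, ?_⟩
      rintro e ⟨rfl | he, hwe⟩
      · rfl
      · exact absurd hwuv ((h.1 e he).2 w hwe).2
    · obtain ⟨e, ⟨he, hwe⟩, huniq⟩ := h.2 w ⟨hw, hwuv⟩
      refine ⟨e, ⟨Or.inr he, hwe⟩, ?_⟩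
      rintro e' ⟨rfl | he', hwe'⟩
      · exact absurd (by simpa using hwe') hwuv
      · exact huniq e' ⟨he', hwe'⟩

theorem IsPMOn.eq_of_mem {G : SimpleGraph V} {S : Set V} {M : Set (Sym2 V)}
    (h : IsPMOn G S M) {e e' : Sym2 V} {w : V} (he : e ∈ M) (he' : e' ∈ M) (hw : w ∈ e)
    (hw' : w ∈ e') : e = e' :=
  (h.2 w ((h.1 e he).2 w hw)).unique ⟨he, hw⟩ ⟨he', hw'⟩

theorem IsPMOn.erase {G : SimpleGraph V} {S : Set V} {u v : V} {M : Set (Sym2 V)}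
    (h : IsPMOn G S M) (huv : s(u, v) ∈ M) : IsPMOn G (S \ {u, v}) (M \ {s(u, v)}) := by
  refine ⟨fun e he => ⟨(h.1 e he.1).1, fun x hx => ⟨(h.1 e he.1).2 x hx, fun hxuv => ?_⟩⟩,
    fun w hw => ?_⟩
  · exact he.2 (h.eq_of_mem he.1 huv hx (by simpa using hxuv))
  · obtain ⟨e, ⟨he, hwe⟩, huniq⟩ := h.2 w hw.1
    refine ⟨e, ⟨⟨he, ?_⟩, hwe⟩, fun e' he' => huniq e' ⟨he'.1.1, he'.2⟩⟩
    rintro rfl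
    exact hw.2 (by simpa using hwe)

theorem pmCount_eq_add [Finite V] {G : SimpleGraph V} {S : Set V} {u v : V}
    (huv : G.Adj u v) (hu : u ∈ S) (hv : v ∈ S) :
    pmCount G S = pmCount (G.deleteEdges {s(u, v)}) S + pmCount G (S \ {u, v}) := by
  have hnot : ∀ M, IsPMOn G (S \ {u, v}) M → s(u, v) ∉ M := fun M hM h =>
    ((hM.1 _ h).2 u (by simp)).2 (by simp)
  have h1 : {M | IsPMOn G S M} = {M | IsPMOn (G.deleteEdges {s(u, v)}) S M} ∪
      (insert s(u, v)) '' {M | IsPMOn G (S \ {u, v}) M} := by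
    ext M
    constructor
    · intro hM
      by_cases h : s(u, v) ∈ M
      · exact Or.inr ⟨M \ {s(u, v)}, hM.erase h, by simp [h]⟩
      · refine Or.inl ⟨fun e he => ⟨?_, (hM.1 e he).2⟩, hM.2⟩
        rw [SimpleGraph.edgeSet_deleteEdges]
        exact ⟨(hM.1 e he).1, fun h' => h (by rwa [← Set.mem_singleton_iff.1 h'])⟩
    · rintro (hM | ⟨M, hM, rfl⟩)
      · refine ⟨fun e he => ⟨?_, (hM.1 e he).2⟩, hM.2⟩
        have := (hM.1 e he).1
        rw [SimpleGraph.edgeSet_deleteEdges] at this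
        exact this.1
      · exact hM.insert huv hu hv
  have h2 : Disjoint {M | IsPMOn (G.deleteEdges {s(u, v)}) S M}
      ((insert s(u, v)) '' {M | IsPMOn G (S \ {u, v}) M}) := by
    rw [Set.disjoint_left]
    rintro _ hM ⟨M, -, rfl⟩
    have := (hM.1 s(u, v) (Or.inl rfl)).1
    rw [SimpleGraph.edgeSet_deleteEdges] at this
    exact this.2 rfl
  have h3 : Set.InjOn (insert s(u, v)) {M | IsPMOn G (S \ {u, v}) M} := by
    intro M hM N hN hMN
    have := congrArg (· \ {s(u, v)}) hMN
    simpa [Set.insert_sdiff_of_mem, Set.sdiff_singleton_eq_self, hnot M hM, hnot N hN] using this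
  rw [pmCount, h1, Set.ncard_union_eq h2 (Set.toFinite _) (Set.toFinite _),
    h3.ncard_image]
  rfl

theorem IsPMOn.union {G : SimpleGraph V} {S T : Set V} {M N : Set (Sym2 V)}
    (hM : IsPMOn G S M) (hN : IsPMOn G T N) (hST : Disjoint S T) :
    IsPMOn G (S ∪ T) (M ∪ N) := by
  rw [Set.disjoint_left] at hST
  refine ⟨?_, ?_⟩
  · rintro e (he | he)
    · exact ⟨(hM.1 e he).1, fun x hx => Or.inl ((hM.1 e he).2 x hx)⟩
    · exact ⟨(hN.1 e he).1, fun x hx => Or.inr ((hN.1 e he).2 x hx)⟩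
  · rintro w (hw | hw)
    · obtain ⟨e, ⟨he, hwe⟩, huniq⟩ := hM.2 w hw
      refine ⟨e, ⟨Or.inl he, hwe⟩, ?_⟩
      rintro e' ⟨he' | he', hwe'⟩
      · exact huniq e' ⟨he', hwe'⟩
      · exact absurd ((hN.1 e' he').2 w hwe') (hST hw)
    · obtain ⟨e, ⟨he, hwe⟩, huniq⟩ := hN.2 w hw
      refine ⟨e, ⟨Or.inr he, hwe⟩, ?_⟩
      rintro e' ⟨he' | he', hwe'⟩
      · exact absurd hw (hST ((hM.1 e' he').2 w hwe'))
      · exact huniq e' ⟨he', hwe'⟩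

theorem pmCount_union [Finite V] {G : SimpleGraph V} {S T : Set V} (hST : Disjoint S T)
    (hcross : ∀ x ∈ S, ∀ y ∈ T, ¬G.Adj x y) :
    pmCount G (S ∪ T) = pmCount G S * pmCount G T := by
  have hd := Set.disjoint_left.1 hST
  have h1 : {M | IsPMOn G (S ∪ T) M} = (fun p : Set (Sym2 V) × Set (Sym2 V) => p.1 ∪ p.2) ''
      ({M | IsPMOn G S M} ×ˢ {M | IsPMOn G T M}) := by
    ext M
    constructor
    · intro hM
      have hside : ∀ e ∈ M, (∀ x ∈ e, x ∈ S) ∨ (∀ x ∈ e, x ∈ T) := by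
        intro e he
        have h1 := hM.1 e he
        induction e with
        | h x y =>
          simp only [SimpleGraph.mem_edgeSet, Sym2.mem_iff, forall_eq_or_imp, forall_eq] at h1 ⊢
          obtain ⟨h1, hx | hx, hy | hy⟩ := h1
          · exact Or.inl ⟨hx, hy⟩
          · exact absurd h1 (hcross x hx y hy)
          · exact absurd h1.symm (hcross y hy x hx)
          · exact Or.inr ⟨hx, hy⟩
      refine ⟨({e ∈ M | ∀ x ∈ e, x ∈ S}, {e ∈ M | ∀ x ∈ e, x ∈ T}), ⟨⟨?_, ?_⟩, ?_, ?_⟩, ?_⟩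
      · exact fun e he => ⟨(hM.1 e he.1).1, he.2⟩
      · intro w hw
        obtain ⟨e, ⟨he, hwe⟩, huniq⟩ := hM.2 w (Or.inl hw)
        refine ⟨e, ⟨⟨he, ?_⟩, hwe⟩, fun e' he' => huniq e' ⟨he'.1.1, he'.2⟩⟩
        exact (hside e he).resolve_right fun h => hd hw (h w hwe)
      · exact fun e he => ⟨(hM.1 e he.1).1, he.2⟩
      · intro w hw
        obtain ⟨e, ⟨he, hwe⟩, huniq⟩ := hM.2 w (Or.inr hw)
        refine ⟨e, ⟨⟨he, ?_⟩, hwe⟩, fun e' he' => huniq e' ⟨he'.1.1, he'.2⟩⟩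
        exact (hside e he).resolve_left fun h => hd (h w hwe) hw
      · ext e
        constructor
        · rintro (h | h) <;> exact h.1
        · exact fun h => (hside e h).imp (fun h' => ⟨h, h'⟩) (fun h' => ⟨h, h'⟩)
    · rintro ⟨⟨M, N⟩, ⟨hM, hN⟩, rfl⟩
      exact IsPMOn.union hM hN hST
  have h2 : Set.InjOn (fun p : Set (Sym2 V) × Set (Sym2 V) => p.1 ∪ p.2)
      ({M | IsPMOn G S M} ×ˢ {M | IsPMOn G T M}) := by
    have hsub : ∀ M N M' N' : Set (Sym2 V), IsPMOn G S M → IsPMOn G T N → IsPMOn G S M' →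
        IsPMOn G T N' → M ∪ N = M' ∪ N' → M ⊆ M' ∧ N ⊆ N' := by
      intro M N M' N' hM hN hM' hN' h
      constructor <;> intro e he
      · obtain h' | h' : e ∈ M' ∪ N' := h ▸ Or.inl he
        · exact h'
        · exact absurd ((hN'.1 e h').2 _ e.out_fst_mem)
            (hd ((hM.1 e he).2 _ e.out_fst_mem))
      · obtain h' | h' : e ∈ M' ∪ N' := h ▸ Or.inr he
        · exact absurd ((hN.1 e he).2 _ e.out_fst_mem)
            (hd ((hM'.1 e h').2 _ e.out_fst_mem))
        · exact h'
    rintro ⟨M, N⟩ ⟨hM, hN⟩ ⟨M', N'⟩ ⟨hM', hN'⟩ h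
    have h3 := hsub M N M' N' hM hN hM' hN' h
    have h4 := hsub M' N' M N hM' hN' hM hN h.symm
    exact Prod.ext (h3.1.antisymm h4.1) (h3.2.antisymm h4.2)
  rw [pmCount, h1, h2.ncard_image, Set.ncard_prod]
  rfl

theorem pmCount_union_of_one_edge [Finite V] {G : SimpleGraph V} {S T : Set V} {u v : V}
    (hST : Disjoint S T) (hu : u ∈ S) (hv : v ∈ T)
    (hcross : ∀ x ∈ S, ∀ y ∈ T, (G.Adj x y ↔ x = u ∧ y = v)) :
    pmCount G (S ∪ T) =
      pmCount G S * pmCount G T + pmCount G (S \ {u}) * pmCount G (T \ {v}) := by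
  have hd := Set.disjoint_left.1 hST
  have huT : u ∉ T := hd hu
  have hvS : v ∉ S := fun h => hd h hv
  have hset : (S ∪ T) \ {u, v} = (S \ {u}) ∪ (T \ {v}) := by
    ext x
    simp only [Set.mem_sdiff, Set.mem_union, Set.mem_insert_iff, Set.mem_singleton_iff]
    grind
  rw [pmCount_eq_add ((hcross u hu v hv).2 ⟨rfl, rfl⟩) (Or.inl hu) (Or.inr hv),
    pmCount_union hST, hset, pmCount_union (hST.mono Set.sdiff_subset Set.sdiff_subset)]
  · congr 2 <;> apply pmCount_congr <;> intro x hx y hy <;>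
      simp only [SimpleGraph.deleteEdges_adj, Set.mem_singleton_iff, Sym2.eq_iff] <;> grind
  · intro x hx y hy h
    exact hx.2 ((hcross x hx.1 y hy.1).1 h).1
  · intro x hx y hy
    simp only [SimpleGraph.deleteEdges_adj, Set.mem_singleton_iff, Sym2.eq_iff, hcross x hx y hy]
    grind

theorem pmCount_union_of_two_edges [Finite V] {G : SimpleGraph V} {S T : Set V}
    {u u' v v' : V} (hST : Disjoint S T) (hu : u ∈ S) (hu' : u' ∈ S) (hv : v ∈ T)
    (hv' : v' ∈ T) (huu' : u ≠ u') (hvv' : v ≠ v')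
    (hcross : ∀ x ∈ S, ∀ y ∈ T, (G.Adj x y ↔ (x = u ∧ y = v) ∨ (x = u' ∧ y = v'))) :
    pmCount G (S ∪ T) =
      pmCount G S * pmCount G T + pmCount G (S \ {u'}) * pmCount G (T \ {v'}) +
      (pmCount G (S \ {u}) * pmCount G (T \ {v}) +
        pmCount G (S \ {u, u'}) * pmCount G (T \ {v, v'})) := by
  have hd := Set.disjoint_left.1 hST
  have huT : u ∉ T := hd hu
  have hvS : v ∉ S := fun h => hd h hv
  have hset : (S ∪ T) \ {u, v} = (S \ {u}) ∪ (T \ {v}) := by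
    ext x
    simp only [Set.mem_sdiff, Set.mem_union, Set.mem_insert_iff, Set.mem_singleton_iff]
    grind
  have hsd : ∀ (A : Set V) (x y : V), (A \ {x}) \ {y} = A \ {x, y} := fun A x y => by
    rw [Set.sdiff_sdiff, Set.singleton_union]
  rw [pmCount_eq_add ((hcross u hu v hv).2 (Or.inl ⟨rfl, rfl⟩)) (Or.inl hu) (Or.inr hv),
    pmCount_union_of_one_edge (u := u') (v := v') hST hu' hv', hset,
    pmCount_union_of_one_edge (u := u') (v := v')
      (hST.mono Set.sdiff_subset Set.sdiff_subset) ⟨hu', fun h => huu' h.symm⟩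
      ⟨hv', fun h => hvv' h.symm⟩,
    hsd, hsd]
  · congr 3 <;> apply pmCount_congr <;> intro x hx y hy <;>
      simp only [SimpleGraph.deleteEdges_adj, Set.mem_singleton_iff, Sym2.eq_iff] <;> grind
  · intro x hx y hy
    rw [hcross x hx.1 y hy.1]
    exact or_iff_right fun h => hx.2 h.1
  · intro x hx y hy
    simp only [SimpleGraph.deleteEdges_adj, Set.mem_singleton_iff, Sym2.eq_iff, hcross x hx y hy]
    grind

theorem IsPMOn.even_ncard [Finite V] {G : SimpleGraph V} {S : Set V} {M : Set (Sym2 V)}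
    (h : IsPMOn G S M) : Even S.ncard := by
  induction hn : S.ncard using Nat.strong_induction_on generalizing S M with
  | _ n ih =>
    subst hn
    obtain rfl | ⟨w, hw⟩ := S.eq_empty_or_nonempty
    · simp
    · obtain ⟨e, ⟨he, hwe⟩, -⟩ := h.2 w hw
      obtain ⟨x, rfl⟩ := Sym2.mem_iff_exists.1 hwe
      have hwx : w ≠ x := (h.1 _ he).1.ne
      have hsub : {w, x} ⊆ S := by
        rintro y (rfl | rfl)
        · exact hw
        · exact (h.1 _ he).2 _ (by simp)
      have hcard := Set.ncard_sdiff_add_ncard_of_subset hsub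
      rw [Set.ncard_pair hwx] at hcard
      have := ih _ (by omega) (h.erase he) rfl
      rw [← hcard]
      exact this.add even_two

theorem even_ncard_of_pmCount_ne_zero [Finite V] {G : SimpleGraph V} {S : Set V}
    (h : pmCount G S ≠ 0) : Even S.ncard := by
  obtain ⟨M, hM⟩ := Set.nonempty_of_ncard_ne_zero h
  exact IsPMOn.even_ncard hM

theorem pmCount_eq_zero_of_odd [Finite V] {G : SimpleGraph V} {S : Set V}
    (h : Odd S.ncard) : pmCount G S = 0 := by
  by_contra h0
  exact Nat.not_even_iff_odd.2 h (even_ncard_of_pmCount_ne_zero h0)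

theorem pmCount_empty (G : SimpleGraph V) : pmCount G ∅ = 1 := by
  rw [pmCount, Set.ncard_eq_one]
  refine ⟨∅, ?_⟩
  ext M
  constructor
  · intro h
    exact Set.eq_empty_of_forall_notMem fun e he => (h.1 e he).2 _ e.out_fst_mem
  · rintro rfl
    exact ⟨by simp, by simp⟩

theorem pmCount_singleton [Finite V] (G : SimpleGraph V) (u : V) : pmCount G {u} = 0 :=
  pmCount_eq_zero_of_odd (by simp)

theorem pmCount_pair_of_not_adj [Finite V] {G : SimpleGraph V} {u v : V} (huv : u ≠ v)
    (h : ¬G.Adj u v) : pmCount G {u, v} = 0 := by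
  rw [Set.insert_eq, pmCount_union (by simpa using huv), pmCount_singleton, zero_mul]
  rintro x rfl y rfl
  exact h

theorem pmCount_pair_of_adj [Finite V] {G : SimpleGraph V} {u v : V} (h : G.Adj u v) :
    pmCount G {u, v} = 1 := by
  rw [pmCount_eq_add h (by simp) (by simp), pmCount_pair_of_not_adj h.ne (by simp),
    Set.sdiff_self, pmCount_empty]

theorem pmCount_of_two_edges_of_even [Finite V] {G : SimpleGraph V} {S T Z S' T' : Set V}
    {u u' v v' : V} (hS : Even S.ncard) (hZ : Z = S ∪ T) (hS' : S' = S \ {u, u'})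
    (hT' : T' = T \ {v, v'}) (hST : Disjoint S T) (hu : u ∈ S) (hu' : u' ∈ S) (hv : v ∈ T)
    (hv' : v' ∈ T) (huu' : u ≠ u') (hvv' : v ≠ v')
    (hcross : ∀ x ∈ S, ∀ y ∈ T, (G.Adj x y ↔ (x = u ∧ y = v) ∨ (x = u' ∧ y = v'))) :
    pmCount G Z = pmCount G S * pmCount G T + pmCount G S' * pmCount G T' := by
  have hodd : ∀ x ∈ S, pmCount G (S \ {x}) = 0 := fun x hx => by
    have h := Set.ncard_sdiff_singleton_add_one hx
    refine pmCount_eq_zero_of_odd ?_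
    rw [← h, Nat.even_add_one, Nat.not_even_iff_odd] at hS
    exact hS
  rw [hZ, hS', hT', pmCount_union_of_two_edges hST hu hu' hv hv' huu' hvv' hcross,
    hodd u hu, hodd u' hu']
  ring

theorem pmCount_of_two_edges_of_odd [Finite V] {G : SimpleGraph V}
    {S T Z S₁ T₁ S₂ T₂ : Set V} {u u' v v' : V} (hS : Odd S.ncard) (hZ : Z = S ∪ T)
    (hS₁ : S₁ = S \ {u}) (hT₁ : T₁ = T \ {v}) (hS₂ : S₂ = S \ {u'}) (hT₂ : T₂ = T \ {v'})
    (hST : Disjoint S T) (hu : u ∈ S) (hu' : u' ∈ S) (hv : v ∈ T)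
    (hv' : v' ∈ T) (huu' : u ≠ u') (hvv' : v ≠ v')
    (hcross : ∀ x ∈ S, ∀ y ∈ T, (G.Adj x y ↔ (x = u ∧ y = v) ∨ (x = u' ∧ y = v'))) :
    pmCount G Z = pmCount G S₁ * pmCount G T₁ + pmCount G S₂ * pmCount G T₂ := by
  have hsub : {u, u'} ⊆ S := by
    rintro x (rfl | rfl)
    exacts [hu, hu']
  have h := Set.ncard_sdiff_add_ncard_of_subset hsub
  rw [Set.ncard_pair huu'] at h
  have hS' : Odd (S \ {u, u'}).ncard := by
    rw [← h] at hS
    simpa [Nat.odd_add, parity_simps] using hS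
  rw [hZ, hS₁, hT₁, hS₂, hT₂,
    pmCount_union_of_two_edges hST hu hu' hv hv' huu' hvv' hcross,
    pmCount_eq_zero_of_odd hS, pmCount_eq_zero_of_odd hS']
  ring

/-- The matching counts of the subgraph induced on `st` with respect to four vertices. -/
noncomputable def cornerCounts (G : SimpleGraph V) (st : Set V) (p q r s : V) :
    CornerCounts :=
  ⟨pmCount G st, pmCount G (st \ {p, q}), pmCount G (st \ {p, r}), pmCount G (st \ {p, s}),
    pmCount G (st \ {q, r}), pmCount G (st \ {q, s}), pmCount G (st \ {r, s}),
    pmCount G (st \ {p, q, r, s})⟩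

theorem cornerCounts_swap12 (G : SimpleGraph V) (st : Set V) (p q r s : V) :
    (cornerCounts G st p q r s).swap12 = cornerCounts G st q p r s := by
  simp only [cornerCounts, CornerCounts.swap12, Set.pair_comm q p, Set.insert_comm q p]

theorem cornerCounts_swap23 (G : SimpleGraph V) (st : Set V) (p q r s : V) :
    (cornerCounts G st p q r s).swap23 = cornerCounts G st p r q s := by
  simp only [cornerCounts, CornerCounts.swap23, Set.pair_comm r q, Set.insert_comm r q]

theorem cornerCounts_swap34 (G : SimpleGraph V) (st : Set V) (p q r s : V) :
    (cornerCounts G st p q r s).swap34 = cornerCounts G st p q s r := by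
  simp only [cornerCounts, CornerCounts.swap34, Set.pair_comm s r]

/-- `p, q, r, s` enumerates the set `c` of four vertices of `st`. -/
structure Enumerates (st c : Set V) (p q r s : V) : Prop where
  eq : c = {p, q, r, s}
  pq : p ≠ q
  pr : p ≠ r
  ps : p ≠ s
  qr : q ≠ r
  qs : q ≠ s
  rs : r ≠ s
  hp : p ∈ st
  hq : q ∈ st
  hr : r ∈ st
  hs : s ∈ st

theorem Enumerates.swap12 {st c : Set V} {p q r s : V} (h : Enumerates st c p q r s) :
    Enumerates st c q p r s :=
  ⟨by rw [h.eq, Set.insert_comm], h.pq.symm, h.qr, h.qs, h.pr, h.ps, h.rs, h.hq, h.hp, h.hr,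
    h.hs⟩

theorem Enumerates.swap23 {st c : Set V} {p q r s : V} (h : Enumerates st c p q r s) :
    Enumerates st c p r q s :=
  ⟨by rw [h.eq, Set.insert_comm q], h.pr, h.pq, h.ps, h.qr.symm, h.rs, h.qs, h.hp, h.hr,
    h.hq, h.hs⟩

theorem Enumerates.swap34 {st c : Set V} {p q r s : V} (h : Enumerates st c p q r s) :
    Enumerates st c p q s r :=
  ⟨by rw [h.eq, Set.pair_comm r], h.pq, h.ps, h.pr, h.qs, h.qr, h.rs.symm, h.hp, h.hq,
    h.hs, h.hr⟩

theorem exists_enumeration_of_swaps {P : V → V → V → V → Prop}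
    (h12 : ∀ {p q r s}, P p q r s → P q p r s) (h23 : ∀ {p q r s}, P p q r s → P p r q s)
    (h34 : ∀ {p q r s}, P p q r s → P p q s r) {p q r s u u' : V} (h : P p q r s)
    (hu : u ∈ ({p, q, r, s} : Set V)) (hu' : u' ∈ ({p, q, r, s} : Set V)) (huu' : u ≠ u') :
    ∃ r' s', P u u' r' s' := by
  obtain rfl | rfl | rfl | rfl := hu <;> obtain rfl | rfl | rfl | rfl := hu'
  · exact absurd rfl huu'
  · exact ⟨_, _, h⟩
  · exact ⟨_, _, h23 h⟩
  · exact ⟨_, _, h23 (h34 h)⟩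
  · exact ⟨_, _, h12 h⟩
  · exact absurd rfl huu'
  · exact ⟨_, _, h23 (h12 h)⟩
  · exact ⟨_, _, h23 (h34 (h12 h))⟩
  · exact ⟨_, _, h12 (h23 h)⟩
  · exact ⟨_, _, h23 (h12 (h23 h))⟩
  · exact absurd rfl huu'
  · exact ⟨_, _, h23 (h34 (h12 (h23 h)))⟩
  · exact ⟨_, _, h12 (h23 (h34 h))⟩
  · exact ⟨_, _, h23 (h12 (h23 (h34 h)))⟩
  · exact ⟨_, _, h23 (h34 (h12 (h23 (h34 h))))⟩
  · exact absurd rfl huu'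

theorem exists_enumeration_of_color_swaps {P : V → V → V → V → Prop}
    (h13 : ∀ {p q r s}, P p q r s → P r q p s) (h24 : ∀ {p q r s}, P p q r s → P p s r q)
    (hc : ∀ {p q r s}, P p q r s → P q p s r) {p q r s u u' : V} (h : P p q r s)
    (hu : u ∈ ({p, q, r, s} : Set V)) (hu' : u' ∈ ({p, q, r, s} : Set V)) (huu' : u ≠ u') :
    (∃ r' s', P u u' r' s') ∨ ∃ r' s', P u r' u' s' := by
  obtain rfl | rfl | rfl | rfl := hu <;> obtain rfl | rfl | rfl | rfl := hu'
  · exact absurd rfl huu'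
  · exact Or.inl ⟨_, _, h⟩
  · exact Or.inr ⟨_, _, h⟩
  · exact Or.inl ⟨_, _, h24 h⟩
  · exact Or.inl ⟨_, _, hc h⟩
  · exact absurd rfl huu'
  · exact Or.inl ⟨_, _, hc (h13 h)⟩
  · exact Or.inr ⟨_, _, hc h⟩
  · exact Or.inr ⟨_, _, h13 h⟩
  · exact Or.inl ⟨_, _, h13 h⟩
  · exact absurd rfl huu'
  · exact Or.inl ⟨_, _, h24 (h13 h)⟩
  · exact Or.inl ⟨_, _, hc (h24 h)⟩
  · exact Or.inr ⟨_, _, hc (h24 h)⟩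
  · exact Or.inl ⟨_, _, hc (h24 (h13 h))⟩
  · exact absurd rfl huu'

/-- `C` is one of the two classes of a proper 2-colouring of the subgraph induced on `st`. -/
def IsColorClass (G : SimpleGraph V) (st C : Set V) : Prop :=
  ∀ x ∈ st, ∀ y ∈ st, G.Adj x y → (x ∈ C ↔ y ∉ C)

theorem IsColorClass.compl {G : SimpleGraph V} {st C : Set V} (h : IsColorClass G st C) :
    IsColorClass G st Cᶜ := by
  intro x hx y hy hxy
  have := h x hx y hy hxy
  simp only [Set.mem_compl_iff]
  tauto

theorem IsColorClass.union {G : SimpleGraph V} {st₁ st₂ C₁ C₂ : Set V}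
    (h₁ : IsColorClass G st₁ C₁) (h₂ : IsColorClass G st₂ C₂) (hd : Disjoint st₁ st₂)
    (hcross : ∀ x ∈ st₁, ∀ y ∈ st₂, G.Adj x y → (x ∈ C₁ ↔ y ∉ C₂)) :
    IsColorClass G (st₁ ∪ st₂) ((C₁ ∩ st₁) ∪ (C₂ ∩ st₂)) := by
  rw [Set.disjoint_left] at hd
  rintro x (hx | hx) y (hy | hy) hxy
  · have := h₁ x hx y hy hxy
    simp [hx, hy, hd hx, hd hy, this]
  · have := hcross x hx y hy hxy
    have hy1 : y ∉ st₁ := fun h => hd h hy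
    simp [hx, hy, hy1, hd hx, this]
  · have := hcross y hy x hx hxy.symm
    have hx1 : x ∉ st₁ := fun h => hd h hx
    simp [hx, hy, hx1, hd hy, this]
  · have := h₂ x hx y hy hxy
    have hx1 : x ∉ st₁ := fun h => hd h hx
    have hy1 : y ∉ st₁ := fun h => hd h hy
    simp [hx, hy, hx1, hy1, this]

theorem cornerCounts_mult [Finite V] {G : SimpleGraph V} {st₁ c₁ st₂ c₂ : Set V}
    {u u' r s v v' r' s' : V} (h₁ : Enumerates st₁ c₁ u u' r s)
    (h₂ : Enumerates st₂ c₂ v v' r' s') (heven : Even st₁.ncard) (hd : Disjoint st₁ st₂)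
    (hcross : ∀ x ∈ st₁, ∀ y ∈ st₂, (G.Adj x y ↔ (x = u ∧ y = v) ∨ (x = u' ∧ y = v'))) :
    cornerCounts G (st₁ ∪ st₂) r s r' s' =
      (cornerCounts G st₁ u u' r s).mult (cornerCounts G st₂ v v' r' s') := by
  obtain ⟨-, pq, pr, ps, qr, qs, rs, hp, hq, hr, hs⟩ := h₁
  obtain ⟨-, pq', pr', ps', qr', qs', rs', hp', hq', hr', hs'⟩ := h₂
  have hd1 := Set.disjoint_left.1 hd
  have hd2 := Set.disjoint_right.1 hd
  have hodd : ∀ x ∈ st₁, Odd (st₁ \ {x}).ncard := fun x hx => by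
    rw [← Set.ncard_sdiff_singleton_add_one hx, Nat.even_add_one, Nat.not_even_iff_odd] at heven
    exact heven
  have heven' : Even (st₁ \ {r, s}).ncard := by
    have h := Set.ncard_sdiff_add_ncard_of_subset (Set.pair_subset hr hs)
    rw [Set.ncard_pair rs] at h
    rw [← h] at heven
    simpa [parity_simps] using heven
  have hd' : ∀ X Y : Set V, Disjoint (st₁ \ X) (st₂ \ Y) := fun X Y =>
    hd.mono Set.sdiff_subset Set.sdiff_subset
  have hcross' : ∀ X Y : Set V, ∀ x ∈ st₁ \ X, ∀ y ∈ st₂ \ Y,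
      (G.Adj x y ↔ (x = u ∧ y = v) ∨ (x = u' ∧ y = v')) := fun X Y x hx y hy =>
    hcross x hx.1 y hy.1
  ext <;> simp only [cornerCounts, CornerCounts.mult]
  · exact pmCount_of_two_edges_of_even heven rfl rfl rfl hd hp hq hp' hq' pq pq' hcross
  · refine pmCount_of_two_edges_of_even heven' ?_ ?_ rfl (by simpa using hd' {r, s} ∅) ?_ ?_
      hp' hq' pq pq' (by simpa using hcross' {r, s} ∅) <;>
      (clear hodd heven heven' hcross' hcross hd' hd; grind)
  · refine pmCount_of_two_edges_of_odd (hodd r hr) ?_ ?_ ?_ ?_ ?_ (hd' {r} {r'}) ?_ ?_ ?_ ?_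
      pq pq' (hcross' _ _) <;>
      (clear hodd heven heven' hcross' hcross hd' hd; grind)
  · refine pmCount_of_two_edges_of_odd (hodd r hr) ?_ ?_ ?_ ?_ ?_ (hd' {r} {s'}) ?_ ?_ ?_ ?_
      pq pq' (hcross' _ _) <;>
      (clear hodd heven heven' hcross' hcross hd' hd; grind)
  · refine pmCount_of_two_edges_of_odd (hodd s hs) ?_ ?_ ?_ ?_ ?_ (hd' {s} {r'}) ?_ ?_ ?_ ?_
      pq pq' (hcross' _ _) <;>
      (clear hodd heven heven' hcross' hcross hd' hd; grind)
  · refine pmCount_of_two_edges_of_odd (hodd s hs) ?_ ?_ ?_ ?_ ?_ (hd' {s} {s'}) ?_ ?_ ?_ ?_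
      pq pq' (hcross' _ _) <;>
      (clear hodd heven heven' hcross' hcross hd' hd; grind)
  · refine pmCount_of_two_edges_of_even heven ?_ rfl ?_ (by simpa using hd' ∅ {r', s'}) hp hq
      ?_ ?_ pq pq' (by simpa using hcross' ∅ {r', s'}) <;>
      (clear hodd heven heven' hcross' hcross hd' hd; grind)
  · refine pmCount_of_two_edges_of_even heven' ?_ ?_ ?_ (hd' _ {r', s'}) ?_ ?_ ?_ ?_
      pq pq' (hcross' _ _) <;>
      (clear hodd heven heven' hcross' hcross hd' hd; grind)

theorem cornerCounts_incr [Finite V] {G : SimpleGraph V} {st c : Set V}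
    {u u' r s v v' : V} (h : Enumerates st c u u' r s) (heven : Even st.ncard)
    (hv : v ∉ st) (hv' : v' ∉ st) (hvv' : G.Adj v v')
    (hcross : ∀ x ∈ st, (G.Adj x v ↔ x = u) ∧ (G.Adj x v' ↔ x = u')) :
    cornerCounts G (st ∪ {v, v'}) v' v r s = (cornerCounts G st u u' r s).incr := by
  obtain ⟨-, pq, pr, ps, qr, qs, rs, hp, hq, hr, hs⟩ := h
  have hne := hvv'.ne
  have heven' : Even (st \ {r, s}).ncard := by
    have h := Set.ncard_sdiff_add_ncard_of_subset (Set.pair_subset hr hs)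
    rw [Set.ncard_pair rs] at h
    rw [← h] at heven
    simpa [parity_simps] using heven
  have hd : ∀ X : Set V, Disjoint (st \ X) {v, v'} := fun X => by
    rw [Set.disjoint_left]
    rintro x hx (rfl | rfl)
    exacts [hv hx.1, hv' hx.1]
  have hd1 : ∀ X : Set V, Disjoint (st \ X) {v} := fun X =>
    (hd X).mono_right (by simp)
  have hd1' : ∀ X : Set V, Disjoint (st \ X) {v'} := fun X =>
    (hd X).mono_right (by simp)
  have hc2 : ∀ X : Set V, ∀ x ∈ st \ X, ∀ y ∈ ({v, v'} : Set V),
      (G.Adj x y ↔ (x = u ∧ y = v) ∨ (x = u' ∧ y = v')) := by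
    rintro X x hx y (rfl | rfl)
    · rw [(hcross x hx.1).1]
      simp [hne]
    · rw [(hcross x hx.1).2]
      simp [hne.symm]
  have hc1 : ∀ X : Set V, ∀ x ∈ st \ X, ∀ y ∈ ({v} : Set V),
      (G.Adj x y ↔ x = u ∧ y = v) := by
    rintro X x hx y rfl
    rw [(hcross x hx.1).1]
    simp
  have hc1' : ∀ X : Set V, ∀ x ∈ st \ X, ∀ y ∈ ({v'} : Set V),
      (G.Adj x y ↔ x = u' ∧ y = v') := by
    rintro X x hx y rfl
    rw [(hcross x hx.1).2]
    simp
  have hone : ∀ {Z S' : Set V} (t : V), t ∈ st → t ≠ u → Z = st \ {t} ∪ {v} →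
      S' = (st \ {t}) \ {u} → pmCount G Z = pmCount G S' := by
    rintro Z S' t - htu rfl rfl
    rw [pmCount_union_of_one_edge (hd1 {t}) ⟨hp, fun h => htu h.symm⟩ rfl (hc1 {t}),
      pmCount_singleton, Set.sdiff_self, pmCount_empty, mul_zero, zero_add, mul_one]
  have hone' : ∀ {Z S' : Set V} (t : V), t ∈ st → t ≠ u' → Z = st \ {t} ∪ {v'} →
      S' = (st \ {t}) \ {u'} → pmCount G Z = pmCount G S' := by
    rintro Z S' t - htu rfl rfl
    rw [pmCount_union_of_one_edge (hd1' {t}) ⟨hq, fun h => htu h.symm⟩ rfl (hc1' {t}),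
      pmCount_singleton, Set.sdiff_self, pmCount_empty, mul_zero, zero_add, mul_one]
  ext <;> simp only [cornerCounts, CornerCounts.incr]
  · rw [pmCount_of_two_edges_of_even (T := {v, v'}) heven rfl rfl rfl (by simpa using hd ∅) hp hq
      (Set.mem_insert _ _) (Set.mem_insert_of_mem _ rfl) pq hne (by simpa using hc2 ∅),
      pmCount_pair_of_adj hvv', Set.sdiff_self, pmCount_empty, mul_one, mul_one]
  · congr 1
    clear hone hone' hc1 hc1' hc2 hcross hd hd1 hd1' heven heven'
    grind
  · refine hone r hr pr.symm ?_ ?_ <;>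
      (clear hone hone' hc1 hc1' hc2 hcross hd hd1 hd1' heven heven'; grind)
  · refine hone s hs ps.symm ?_ ?_ <;>
      (clear hone hone' hc1 hc1' hc2 hcross hd hd1 hd1' heven heven'; grind)
  · refine hone' r hr qr.symm ?_ ?_ <;>
      (clear hone hone' hc1 hc1' hc2 hcross hd hd1 hd1' heven heven'; grind)
  · refine hone' s hs qs.symm ?_ ?_ <;>
      (clear hone hone' hc1 hc1' hc2 hcross hd hd1 hd1' heven heven'; grind)
  · rw [pmCount_of_two_edges_of_even (S := st \ {r, s}) (T := {v, v'})
      (S' := st \ {u, u', r, s}) heven' ?_ ?_ rfl (hd _) ?_ ?_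
      (Set.mem_insert _ _) (Set.mem_insert_of_mem _ rfl) pq hne (hc2 _),
      pmCount_pair_of_adj hvv', Set.sdiff_self, pmCount_empty, mul_one, mul_one] <;>
      (clear hone hone' hc1 hc1' hc2 hcross hd hd1 hd1' heven heven'; grind)
  · congr 1
    clear hone hone' hc1 hc1' hc2 hcross hd hd1 hd1' heven heven'
    grind

/-- The four vertices `p, q, r, s` enumerate `c`, and their matching counts satisfy the
invariants of non-bipartite twisted nets. -/
def NonBipEnum (G : SimpleGraph V) (st c : Set V) (p q r s : V) : Prop :=
  Enumerates st c p q r s ∧ (cornerCounts G st p q r s).NonBip st.ncard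

/-- The four vertices `p, q, r, s` enumerate `c`, are alternately coloured in a proper
2-colouring, and their matching counts satisfy the invariants of bipartite twisted nets. -/
def BipEnum (G : SimpleGraph V) (st c : Set V) (p q r s : V) : Prop :=
  Enumerates st c p q r s ∧ (cornerCounts G st p q r s).Bip st.ncard ∧
    ∃ C, IsColorClass G st C ∧ p ∈ C ∧ q ∉ C ∧ r ∈ C ∧ s ∉ C

/-- Some enumeration of `c` satisfies one of the two kinds of invariants. -/
def HasInvariants (G : SimpleGraph V) (st c : Set V) : Prop :=
  ∃ p q r s, NonBipEnum G st c p q r s ∨ BipEnum G st c p q r s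

theorem even_ncard_of_two_le [Finite V] {G : SimpleGraph V} {st : Set V} {p q r s : V}
    (h : 2 ≤ (cornerCounts G st p q r s).e) : Even st.ncard :=
  even_ncard_of_pmCount_ne_zero (Nat.ne_of_gt (lt_of_lt_of_le zero_lt_two h))

theorem NonBipEnum.exists_of_mem {G : SimpleGraph V} {st c : Set V} {p q r s u u' : V}
    (h : NonBipEnum G st c p q r s) (hu : u ∈ c) (hu' : u' ∈ c) (huu' : u ≠ u') :
    ∃ r' s', NonBipEnum G st c u u' r' s' := by
  rw [h.1.eq] at hu hu'
  exact exists_enumeration_of_swaps (P := NonBipEnum G st c)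
    (fun h => ⟨h.1.swap12, cornerCounts_swap12 G st _ _ _ _ ▸ h.2.swap12⟩)
    (fun h => ⟨h.1.swap23, cornerCounts_swap23 G st _ _ _ _ ▸ h.2.swap23⟩)
    (fun h => ⟨h.1.swap34, cornerCounts_swap34 G st _ _ _ _ ▸ h.2.swap34⟩) h hu hu' huu'

theorem BipEnum.exists_of_mem {G : SimpleGraph V} {st c : Set V} {p q r s u u' : V}
    (h : BipEnum G st c p q r s) (hu : u ∈ c) (hu' : u' ∈ c) (huu' : u ≠ u') :
    (∃ r' s', BipEnum G st c u u' r' s') ∨ ∃ r' s', BipEnum G st c u r' u' s' := by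
  rw [h.1.eq] at hu hu'
  refine exists_enumeration_of_color_swaps (P := BipEnum G st c) ?_ ?_ ?_ h hu hu' huu'
  · rintro p q r s ⟨h1, h2, C, h3, h4, h5, h6, h7⟩
    refine ⟨h1.swap12.swap23.swap12, ?_, C, h3, h6, h5, h4, h7⟩
    simpa only [cornerCounts_swap12, cornerCounts_swap23] using h2.swap13
  · rintro p q r s ⟨h1, h2, C, h3, h4, h5, h6, h7⟩
    refine ⟨h1.swap23.swap34.swap23, ?_, C, h3, h4, h7, h6, h5⟩
    simpa only [cornerCounts_swap34, cornerCounts_swap23] using h2.swap24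
  · rintro p q r s ⟨h1, h2, C, h3, h4, h5, h6, h7⟩
    refine ⟨h1.swap12.swap34, ?_, Cᶜ, h3.compl, h5, fun h => h h4, h7, fun h => h h6⟩
    simpa only [cornerCounts_swap34, cornerCounts_swap12] using h2.swap_colors

theorem Enumerates.mult {st₁ c₁ st₂ c₂ : Set V} {u u' r s v v' r' s' : V}
    (h₁ : Enumerates st₁ c₁ u u' r s) (h₂ : Enumerates st₂ c₂ v v' r' s')
    (hd : Disjoint st₁ st₂) :
    Enumerates (st₁ ∪ st₂) ((c₁ \ {u, u'}) ∪ (c₂ \ {v, v'})) r s r' s' := by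
  have hne : ∀ {x y}, x ∈ st₁ → y ∈ st₂ → x ≠ y := fun hx hy h =>
    Set.disjoint_left.1 hd hx (h ▸ hy)
  refine ⟨?_, h₁.rs, hne h₁.hr h₂.hr, hne h₁.hr h₂.hs, hne h₁.hs h₂.hr, hne h₁.hs h₂.hs,
    h₂.rs, Or.inl h₁.hr, Or.inl h₁.hs, Or.inr h₂.hr, Or.inr h₂.hs⟩
  obtain ⟨rfl, pq, pr, ps, qr, qs, rs, hp, hq, hr, hs⟩ := h₁
  obtain ⟨rfl, pq', pr', ps', qr', qs', rs', hp', hq', hr', hs'⟩ := h₂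
  clear hne hd
  grind

theorem Enumerates.incr {st c : Set V} {u u' r s v v' : V}
    (h : Enumerates st c u u' r s) (hv : v ∉ st) (hv' : v' ∉ st) (hvv' : v ≠ v') :
    Enumerates (st ∪ {v, v'}) ((c \ {u, u'}) ∪ {v, v'}) v' v r s := by
  refine ⟨?_, hvv'.symm, fun e => hv' (e ▸ h.hr), fun e => hv' (e ▸ h.hs),
    fun e => hv (e ▸ h.hr), fun e => hv (e ▸ h.hs), h.rs, by simp, by simp,
    Or.inl h.hr, Or.inl h.hs⟩
  obtain ⟨rfl, pq, pr, ps, qr, qs, rs, hp, hq, hr, hs⟩ := h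
  grind

theorem HasInvariants.incr [Finite V] {G : SimpleGraph V} {st c : Set V} {u u' v v' : V}
    (h : HasInvariants G st c) (hu : u ∈ c) (hu' : u' ∈ c) (huu' : u ≠ u')
    (hv : v ∉ st) (hv' : v' ∉ st) (hvv' : G.Adj v v')
    (hcross : ∀ x ∈ st, (G.Adj x v ↔ x = u) ∧ (G.Adj x v' ↔ x = u')) :
    HasInvariants G (st ∪ {v, v'}) ((c \ {u, u'}) ∪ {v, v'}) := by
  have hd : Disjoint st {v, v'} := by
    rw [Set.disjoint_left]
    rintro x hx (rfl | rfl)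
    exacts [hv hx, hv' hx]
  have hcard : (st ∪ {v, v'}).ncard = st.ncard + 2 := by
    rw [Set.ncard_union_eq hd (Set.toFinite _) (Set.toFinite _), Set.ncard_pair hvv'.ne]
  obtain ⟨p, q, r, s, h | h⟩ := h
  · obtain ⟨r', s', h1, h2⟩ := h.exists_of_mem hu hu' huu'
    refine ⟨v', v, r', s', Or.inl ⟨h1.incr hv hv' hvv'.ne, ?_⟩⟩
    rw [cornerCounts_incr h1 (even_ncard_of_two_le h2.e_ge) hv hv' hvv' hcross, hcard]
    exact h2.incr
  · obtain ⟨r', s', h1, h2, C, h3, h4, h5, h6, h7⟩ | ⟨r', s', h1, h2, -⟩ :=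
      h.exists_of_mem hu hu' huu'
    · refine ⟨v', v, r', s', Or.inr ⟨h1.incr hv hv' hvv'.ne, ?_, _,
        h3.union (st₂ := {v, v'}) (C₂ := {v'}) ?_ hd ?_, ?_, ?_, ?_, ?_⟩⟩
      · rw [cornerCounts_incr h1 (even_ncard_of_two_le h2.e_ge) hv hv' hvv' hcross, hcard]
        exact h2.incr
      · rintro x (rfl | rfl) y (rfl | rfl) hxy
        · exact absurd rfl hxy.ne
        · simp [hvv'.ne]
        · simp [hvv'.ne]
        · exact absurd rfl hxy.ne
      · rintro x hx y (rfl | rfl) hxy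
        · rw [(hcross x hx).1] at hxy
          subst hxy
          simp [h4, hvv'.ne]
        · rw [(hcross x hx).2] at hxy
          subst hxy
          simp [h5]
      · simp
      · simp [hv, hvv'.ne]
      · simp [h6, h1.hr]
      · have : s' ≠ v' := fun e => hv' (e ▸ h1.hs)
        simp [h7, this]
    · refine ⟨v', v, r', s', Or.inl ⟨h1.swap23.incr hv hv' hvv'.ne, ?_⟩⟩
      rw [cornerCounts_incr h1.swap23 (even_ncard_of_two_le h2.e_ge) hv hv' hvv' hcross, hcard,
        ← cornerCounts_swap23]
      exact h2.incr_same

theorem NonBipEnum.hasInvariants_mult [Finite V] {G : SimpleGraph V}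
    {st₁ c₁ st₂ c₂ : Set V} {u u' v v' p q r s : V}
    (h₁ : NonBipEnum G st₁ c₁ p q r s) (h₂ : HasInvariants G st₂ c₂)
    (hd : Disjoint st₁ st₂) (hu : u ∈ c₁) (hu' : u' ∈ c₁) (huu' : u ≠ u')
    (hv : v ∈ c₂) (hv' : v' ∈ c₂) (hvv' : v ≠ v')
    (hcross : ∀ x ∈ st₁, ∀ y ∈ st₂, (G.Adj x y ↔ (x = u ∧ y = v) ∨ (x = u' ∧ y = v'))) :
    HasInvariants G (st₁ ∪ st₂) ((c₁ \ {u, u'}) ∪ (c₂ \ {v, v'})) := by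
  have hcard := Set.ncard_union_eq hd (Set.toFinite _) (Set.toFinite _)
  obtain ⟨r₁, s₁, k1, k2⟩ := h₁.exists_of_mem hu hu' huu'
  have heven := even_ncard_of_two_le k2.e_ge
  obtain ⟨_, _, _, _, h₂ | h₂⟩ := h₂
  · obtain ⟨r₂, s₂, l1, l2⟩ := h₂.exists_of_mem hv hv' hvv'
    refine ⟨r₁, s₁, r₂, s₂, Or.inl ⟨k1.mult l1 hd, ?_⟩⟩
    rw [cornerCounts_mult k1 l1 heven hd hcross, hcard]
    exact k2.mult l2
  · obtain ⟨r₂, s₂, l1, l2, -⟩ | ⟨r₂, s₂, l1, l2, -⟩ := h₂.exists_of_mem hv hv' hvv'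
    · refine ⟨r₁, s₁, r₂, s₂, Or.inl ⟨k1.mult l1 hd, ?_⟩⟩
      rw [cornerCounts_mult k1 l1 heven hd hcross, hcard]
      exact k2.mult_bip l2
    · refine ⟨r₁, s₁, r₂, s₂, Or.inl ⟨k1.mult l1.swap23 hd, ?_⟩⟩
      rw [cornerCounts_mult k1 l1.swap23 heven hd hcross, hcard, ← cornerCounts_swap23 G st₂]
      exact k2.mult_bip_same l2

theorem BipEnum.hasInvariants_mult_same [Finite V] {G : SimpleGraph V}
    {st₁ c₁ st₂ c₂ : Set V} {u u' v v' r₁ s₁ r₂ s₂ : V}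
    (h₁ : BipEnum G st₁ c₁ u u' r₁ s₁) (h₂ : BipEnum G st₂ c₂ v r₂ v' s₂)
    (hd : Disjoint st₁ st₂)
    (hcross : ∀ x ∈ st₁, ∀ y ∈ st₂, (G.Adj x y ↔ (x = u ∧ y = v) ∨ (x = u' ∧ y = v'))) :
    HasInvariants G (st₁ ∪ st₂) ((c₁ \ {u, u'}) ∪ (c₂ \ {v, v'})) := by
  have hcard := Set.ncard_union_eq hd (Set.toFinite _) (Set.toFinite _)
  obtain ⟨k1, k2, -⟩ := h₁
  obtain ⟨l1, l2, -⟩ := h₂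
  refine ⟨r₁, s₁, r₂, s₂, Or.inl ⟨k1.mult l1.swap23 hd, ?_⟩⟩
  rw [cornerCounts_mult k1 l1.swap23 (even_ncard_of_two_le k2.e_ge) hd hcross, hcard,
    ← cornerCounts_swap23 G st₂]
  exact k2.mult_same l2

theorem cross_symm {G : SimpleGraph V} {st₁ st₂ : Set V} {u u' v v' : V}
    (hcross : ∀ x ∈ st₁, ∀ y ∈ st₂, (G.Adj x y ↔ (x = u ∧ y = v) ∨ (x = u' ∧ y = v'))) :
    ∀ y ∈ st₂, ∀ x ∈ st₁, (G.Adj y x ↔ (y = v ∧ x = u) ∨ (y = v' ∧ x = u')) := by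
  intro y hy x hx
  rw [G.adj_comm, hcross x hx y hy]
  tauto

theorem BipEnum.hasInvariants_mult [Finite V] {G : SimpleGraph V}
    {st₁ c₁ st₂ c₂ : Set V} {u u' v v' p q r s p' q' r' s' : V}
    (h₁ : BipEnum G st₁ c₁ p q r s) (h₂ : BipEnum G st₂ c₂ p' q' r' s')
    (hd : Disjoint st₁ st₂) (hu : u ∈ c₁) (hu' : u' ∈ c₁) (huu' : u ≠ u')
    (hv : v ∈ c₂) (hv' : v' ∈ c₂) (hvv' : v ≠ v')
    (hcross : ∀ x ∈ st₁, ∀ y ∈ st₂, (G.Adj x y ↔ (x = u ∧ y = v) ∨ (x = u' ∧ y = v'))) :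
    HasInvariants G (st₁ ∪ st₂) ((c₁ \ {u, u'}) ∪ (c₂ \ {v, v'})) := by
  have hcard := Set.ncard_union_eq hd (Set.toFinite _) (Set.toFinite _)
  have hd1 := Set.disjoint_left.1 hd
  have hd2 := Set.disjoint_right.1 hd
  obtain ⟨r₁, s₁, h₁⟩ | ⟨r₁, s₁, h₁⟩ := h₁.exists_of_mem hu hu' huu' <;>
    obtain ⟨r₂, s₂, h₂⟩ | ⟨r₂, s₂, h₂⟩ := h₂.exists_of_mem hv hv' hvv'
  · obtain ⟨k1, k2, C₁, k3, k4, k5, k6, k7⟩ := h₁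
    obtain ⟨l1, l2, C₂, l3, l4, l5, l6, l7⟩ := h₂
    refine ⟨r₁, s₁, s₂, r₂, Or.inr ⟨(k1.mult l1 hd).swap34, ?_, _, k3.union l3.compl hd ?_,
      ?_, ?_, ?_, ?_⟩⟩
    · rw [← cornerCounts_swap34,
        cornerCounts_mult k1 l1 (even_ncard_of_two_le k2.e_ge) hd hcross, hcard]
      exact k2.mult l2
    · intro x hx y hy hxy
      obtain ⟨rfl, rfl⟩ | ⟨rfl, rfl⟩ := (hcross x hx y hy).1 hxy <;> simp [*]
    · exact Or.inl ⟨k6, k1.hr⟩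
    · simp [k7, hd1 k1.hs]
    · exact Or.inr ⟨l7, l1.hs⟩
    · simp [l6, hd2 l1.hr]
  · exact h₁.hasInvariants_mult_same h₂ hd hcross
  · rw [Set.union_comm, Set.union_comm (c₁ \ _)]
    exact h₂.hasInvariants_mult_same h₁ hd.symm (cross_symm hcross)
  · obtain ⟨k1, k2, C₁, k3, k4, k5, k6, k7⟩ := h₁
    obtain ⟨l1, l2, C₂, l3, l4, l5, l6, l7⟩ := h₂
    refine ⟨r₁, r₂, s₁, s₂, Or.inr ⟨(k1.swap23.mult l1.swap23 hd).swap23, ?_, _,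
      k3.compl.union l3 hd ?_, ?_, ?_, ?_, ?_⟩⟩
    · rw [← cornerCounts_swap23,
        cornerCounts_mult k1.swap23 l1.swap23 (even_ncard_of_two_le k2.e_ge) hd hcross, hcard,
        ← cornerCounts_swap23 G st₁, ← cornerCounts_swap23 G st₂]
      exact k2.same_mult_same l2
    · intro x hx y hy hxy
      obtain ⟨rfl, rfl⟩ | ⟨rfl, rfl⟩ := (hcross x hx y hy).1 hxy <;> simp [*]
    · exact Or.inl ⟨k5, k1.hq⟩
    · simp [l5, hd2 l1.hq]
    · exact Or.inl ⟨k7, k1.hs⟩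
    · simp [l7, hd2 l1.hs]

theorem HasInvariants.mult [Finite V] {G : SimpleGraph V}
    {st₁ c₁ st₂ c₂ : Set V} {u u' v v' : V}
    (h₁ : HasInvariants G st₁ c₁) (h₂ : HasInvariants G st₂ c₂)
    (hd : Disjoint st₁ st₂) (hu : u ∈ c₁) (hu' : u' ∈ c₁) (huu' : u ≠ u')
    (hv : v ∈ c₂) (hv' : v' ∈ c₂) (hvv' : v ≠ v')
    (hcross : ∀ x ∈ st₁, ∀ y ∈ st₂, (G.Adj x y ↔ (x = u ∧ y = v) ∨ (x = u' ∧ y = v'))) :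
    HasInvariants G (st₁ ∪ st₂) ((c₁ \ {u, u'}) ∪ (c₂ \ {v, v'})) := by
  have h₁' := h₁
  obtain ⟨_, _, _, _, h₁ | h₁⟩ := h₁
  · exact h₁.hasInvariants_mult h₂ hd hu hu' huu' hv hv' hvv' hcross
  · obtain ⟨_, _, _, _, h₂ | h₂⟩ := h₂
    · rw [Set.union_comm, Set.union_comm (c₁ \ _)]
      exact h₂.hasInvariants_mult h₁' hd.symm hv hv' hvv' hu hu' huu' (cross_symm hcross)
    · exact h₁.hasInvariants_mult h₂ hd hu hu' huu' hv hv' hvv' hcross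

theorem hasInvariants_cycle [Finite V] {G : SimpleGraph V} {a b c d : V}
    (hab : a ≠ b) (hac : a ≠ c) (had : a ≠ d) (hbc : b ≠ c) (hbd : b ≠ d) (hcd : c ≠ d)
    (hadj : ∀ x ∈ ({a, b, c, d} : Set V), ∀ y ∈ ({a, b, c, d} : Set V),
      (G.Adj x y ↔ s(x, y) ∈ ({s(a, b), s(b, c), s(c, d), s(d, a)} : Set (Sym2 V)))) :
    HasInvariants G {a, b, c, d} {a, b, c, d} := by
  have adj_ab : G.Adj a b := by rw [hadj] <;> simp
  have adj_bc : G.Adj b c := by rw [hadj] <;> simp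
  have adj_cd : G.Adj c d := by rw [hadj] <;> simp
  have adj_ad : G.Adj a d := by rw [hadj] <;> simp
  have nadj_ac : ¬G.Adj a c := by
    rw [hadj] <;> simp [hac.symm, had, hbc.symm, hcd, hac, hab]
  have nadj_bd : ¬G.Adj b d := by
    rw [hadj] <;> simp [hab.symm, hbd, hbd.symm, hbc, had.symm, hcd.symm]
  clear hadj
  have hcard : ({a, b, c, d} : Set V).ncard = 4 := by
    rw [Set.ncard_insert_of_notMem (by simp [*]), Set.ncard_insert_of_notMem (by simp [*]),
      Set.ncard_pair hcd]
  have hd : Disjoint ({a, b} : Set V) {c, d} := by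
    rw [Set.disjoint_left]
    grind
  have he : pmCount G {a, b, c, d} = 2 := by
    rw [pmCount_of_two_edges_of_even (S := {a, b}) (T := {c, d}) (S' := ∅) (T' := ∅)
      (u := a) (u' := b) (v := d) (v' := c) (by rw [Set.ncard_pair hab]; exact even_two)
      (by grind) (by grind) (by grind) hd (by simp) (by simp) (by simp) (by simp) hab hcd.symm
      ?_,
      pmCount_pair_of_adj adj_ab, pmCount_pair_of_adj adj_cd, pmCount_empty]
    rintro x (rfl | rfl) y (rfl | rfl) <;> simp [*, hab.symm, hcd.symm]
  have h12 : pmCount G ({a, b, c, d} \ {a, b}) = 1 := by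
    rw [show ({a, b, c, d} : Set V) \ {a, b} = {c, d} by grind, pmCount_pair_of_adj adj_cd]
  have h13 : pmCount G ({a, b, c, d} \ {a, c}) = 0 := by
    rw [show ({a, b, c, d} : Set V) \ {a, c} = {b, d} by grind,
      pmCount_pair_of_not_adj hbd nadj_bd]
  have h14 : pmCount G ({a, b, c, d} \ {a, d}) = 1 := by
    rw [show ({a, b, c, d} : Set V) \ {a, d} = {b, c} by grind, pmCount_pair_of_adj adj_bc]
  have h23 : pmCount G ({a, b, c, d} \ {b, c}) = 1 := by
    rw [show ({a, b, c, d} : Set V) \ {b, c} = {a, d} by grind, pmCount_pair_of_adj adj_ad]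
  have h24 : pmCount G ({a, b, c, d} \ {b, d}) = 0 := by
    rw [show ({a, b, c, d} : Set V) \ {b, d} = {a, c} by grind,
      pmCount_pair_of_not_adj hac nadj_ac]
  have h34 : pmCount G ({a, b, c, d} \ {c, d}) = 1 := by
    rw [show ({a, b, c, d} : Set V) \ {c, d} = {a, b} by grind, pmCount_pair_of_adj adj_ab]
  have hf : pmCount G ({a, b, c, d} \ {a, b, c, d}) = 1 := by
    rw [Set.sdiff_self, pmCount_empty]
  refine ⟨a, b, c, d, Or.inr ⟨⟨rfl, hab, hac, had, hbc, hbd, hcd, by simp, by simp, by simp,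
    by simp⟩, ?_, {a, c}, ?_, by simp, ?_, by simp, ?_⟩⟩
  · simp only [cornerCounts, hcard, he, h12, h13, h14, h23, h24, h34, hf]
    refine ⟨by constructor <;> norm_num, ?_, ?_, ?_, ?_, ?_, ?_, ?_, ?_, ?_⟩ <;> norm_num
  · intro x hx y hy hxy
    have hyx := hxy.symm
    have hne := hxy.ne
    obtain rfl | rfl | rfl | rfl := hx <;> obtain rfl | rfl | rfl | rfl := hy <;>
      simp [*, Ne.symm] <;> grind
  · simp [hab.symm, hbc]
  · simp [had.symm, hcd.symm]

theorem IsTwistedNet.hasInvariants [Finite V] {G : SimpleGraph V} {st c : Set V}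
    (h : IsTwistedNet G st c) : HasInvariants G st c := by
  induction h with
  | cyc4 a b c d hab hac had hbc hbd hcd hadj =>
    exact hasInvariants_cycle hab hac had hbc hbd hcd hadj
  | incr st c u u' v v' _ hu hu' huu' hv hv' _ hvv' _ _ hcross ih =>
    exact ih.incr hu hu' huu' hv hv' hvv' hcross
  | mult st₁ c₁ st₂ c₂ u u' v v' _ _ hdisj hu hu' huu' hv hv' hvv' _ _ hcross ih₁ ih₂ =>
    exact ih₁.mult ih₂ (Set.disjoint_iff_inter_eq_empty.2 hdisj) hu hu' huu' hv hv' hvv' hcross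

theorem two_rpow_le_prod_pmCount [Fintype V] {G : SimpleGraph V} {p q r s : V}
    (h : (cornerCounts G Set.univ p q r s).NonBip (Set.univ : Set V).ncard) :
    (2 : ℝ) ^ ((Fintype.card V : ℝ) / 18 + 4 / 9) ≤
      ((pmCount G (Set.univ \ {p, q}) * pmCount G (Set.univ \ {p, r}) *
        pmCount G (Set.univ \ {p, s}) * pmCount G (Set.univ \ {q, r}) *
        pmCount G (Set.univ \ {q, s}) * pmCount G (Set.univ \ {r, s}) : ℕ) : ℝ) := by
  have h1 := h.two_rpow_le
  rw [Set.ncard_univ, Nat.card_eq_fintype_card] at h1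
  simp only [cornerCounts] at h1
  refine h1.trans (le_of_eq ?_)
  push_cast
  ring

/-- Non-bipartite twisted nets: if `G` is a non-bipartite twisted net with `n` vertices
and corners `v₁, v₂, v₃, v₄`, and `m_{ij}` is the number of perfect matchings of
`G \ {v_i, v_j}`, then the product of the six numbers `m_{ij}` is at least
`2^(n/18 + 4/9)`; in particular each `m_{ij}` is at least one. -/
theorem nonbipartite_twisted_net_matchings
    [Fintype V] (G : SimpleGraph V) (v₁ v₂ v₃ v₄ : V)
    (h12 : v₁ ≠ v₂) (h13 : v₁ ≠ v₃) (h14 : v₁ ≠ v₄)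
    (h23 : v₂ ≠ v₃) (h24 : v₂ ≠ v₄) (h34 : v₃ ≠ v₄)
    (h : IsTwistedNet G Set.univ {v₁, v₂, v₃, v₄})
    (hnbip : ¬∃ C : Set V, ∀ x y, G.Adj x y → (x ∈ C ↔ y ∉ C)) :
    (2 : ℝ) ^ ((Fintype.card V : ℝ) / 18 + 4 / 9) ≤
      (({M : Set (Sym2 V) | IsNearPM G Set.univ {v₁, v₂} M}.ncard *
        {M : Set (Sym2 V) | IsNearPM G Set.univ {v₁, v₃} M}.ncard *
        {M : Set (Sym2 V) | IsNearPM G Set.univ {v₁, v₄} M}.ncard *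
        {M : Set (Sym2 V) | IsNearPM G Set.univ {v₂, v₃} M}.ncard *
        {M : Set (Sym2 V) | IsNearPM G Set.univ {v₂, v₄} M}.ncard *
        {M : Set (Sym2 V) | IsNearPM G Set.univ {v₃, v₄} M}.ncard : ℕ) : ℝ) ∧
    (∀ u ∈ ({v₁, v₂, v₃, v₄} : Set V), ∀ v ∈ ({v₁, v₂, v₃, v₄} : Set V), u ≠ v →
      1 ≤ {M : Set (Sym2 V) | IsNearPM G Set.univ {u, v} M}.ncard) := by
  obtain ⟨p, q, r, s, h | ⟨-, -, C, hC, -⟩⟩ := h.hasInvariants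
  · have hpos : ∀ u ∈ ({v₁, v₂, v₃, v₄} : Set V), ∀ v ∈ ({v₁, v₂, v₃, v₄} : Set V), u ≠ v →
        1 ≤ {M : Set (Sym2 V) | IsNearPM G Set.univ {u, v} M}.ncard := by
      intro u hu v hv huv
      obtain ⟨r', s', -, hn⟩ := h.exists_of_mem hu hv huv
      rw [ncard_isNearPM_univ]
      exact hn.a12_pos
    refine ⟨?_, hpos⟩
    obtain ⟨r', s', he, hn⟩ := h.exists_of_mem (u := v₁) (u' := v₂) (by simp) (by simp) h12
    simp only [ncard_isNearPM_univ]
    have h3 : v₃ = r' ∨ v₃ = s' := by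
      have : v₃ ∈ ({v₁, v₂, r', s'} : Set V) := he.eq ▸ by simp
      simpa [h13.symm, h23.symm] using this
    have h4 : v₄ = r' ∨ v₄ = s' := by
      have : v₄ ∈ ({v₁, v₂, r', s'} : Set V) := he.eq ▸ by simp
      simpa [h14.symm, h24.symm] using this
    obtain rfl | rfl := h3
    · obtain rfl | rfl := h4
      · exact absurd rfl h34
      · exact two_rpow_le_prod_pmCount hn
    · obtain rfl | rfl := h4
      · have hn' := hn.swap34
        rw [cornerCounts_swap34] at hn'
        exact two_rpow_le_prod_pmCount hn'
      · exact absurd rfl h34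
  · exact absurd ⟨C, fun x y hxy => hC x trivial y trivial hxy⟩ hnbip
end

section
/- For every twisted net G with n vertices there exist two corners u, v of G such that G \ {u, v} has at least 2^(n/108 − 1/27) perfect matchings. -/
open SimpleGraph
open scoped Classical

universe u

variable {V : Type u}

/-- The invariant maintained for the (lower bounds on the) matching counts of a twisted net on `n`
vertices: `e` is for the whole net, `f` for the net without its corners, and `x₁`, `x₂`, `x₃` are
the products of the counts for complementary pairs of corners. -/
structure GoodCounts (n e f x₁ x₂ x₃ : ℕ) : Prop where
  two_le : 2 ≤ e
  pos₀₁ : 0 < e * f + x₁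
  pos₀₂ : 0 < e * f + x₂
  pos₀₃ : 0 < e * f + x₃
  pos₁₂ : 0 < x₁ + x₂
  pos₁₃ : 0 < x₁ + x₃
  pos₂₃ : 0 < x₂ + x₃
  le₀ : e * f ≤ x₁ + x₂ + x₃
  le₁ : x₁ ≤ e * f + x₂ + x₃
  le₂ : x₂ ≤ e * f + x₁ + x₃
  le₃ : x₃ ≤ e * f + x₁ + x₂
  le_sum : e ≤ x₁ + x₂ + x₃
  four_or : n = 4 ∨ 2 ≤ x₁ ∨ 2 ≤ x₂ ∨ 2 ≤ x₃
  growth : 2 ^ (n + 2) ≤ (e * (max 1 (e * f) * max 1 x₁ * max 1 x₂ * max 1 x₃)) ^ 4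
  growth_pos : 0 < f →
    2 ^ (n + 4) ≤ (e * (max 1 (e * f) * max 1 x₁ * max 1 x₂ * max 1 x₃)) ^ 4

namespace GoodCounts

variable {n e f x₁ x₂ x₃ : ℕ}

lemma swap₁₂ (h : GoodCounts n e f x₁ x₂ x₃) : GoodCounts n e f x₂ x₁ x₃ := by
  obtain ⟨h1, h2, h3, h4, h5, h6, h7, h8, h9, h10, h11, h12, h13, h14, h15⟩ := h
  have : max 1 (e * f) * max 1 x₂ * max 1 x₁ * max 1 x₃ =
    max 1 (e * f) * max 1 x₁ * max 1 x₂ * max 1 x₃ := by ring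
  refine ⟨h1, h3, h2, h4, ?_, h7, h6, ?_, ?_, ?_, ?_, ?_, ?_, ?_, ?_⟩ <;> first
    | omega
    | simpa only [this]

lemma swap₂₃ (h : GoodCounts n e f x₁ x₂ x₃) : GoodCounts n e f x₁ x₃ x₂ := by
  obtain ⟨h1, h2, h3, h4, h5, h6, h7, h8, h9, h10, h11, h12, h13, h14, h15⟩ := h
  have : max 1 (e * f) * max 1 x₁ * max 1 x₃ * max 1 x₂ =
    max 1 (e * f) * max 1 x₁ * max 1 x₂ * max 1 x₃ := by ring
  refine ⟨h1, h2, h4, h3, h6, h5, ?_, ?_, ?_, ?_, ?_, ?_, ?_, ?_, ?_⟩ <;> first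
    | omega
    | simpa only [this]

lemma max_one_mul_le {a b c d : ℕ} (r : ℕ) (hab : 0 < a + b) (hcd : 0 < c + d) :
    max 1 a * max 1 b * (max 1 c * max 1 d) ≤
      max 1 (a * c + b * d + r) * max 1 (b * c + a * d + r) := by
  have hmax {k : ℕ} (hk : 0 < k) : max 1 k = k := max_eq_right hk
  have hr : max 1 (a * c + b * d) * max 1 (b * c + a * d) ≤
      max 1 (a * c + b * d + r) * max 1 (b * c + a * d + r) := 
    Nat.mul_le_mul (max_le_max le_rfl (by omega)) (max_le_max le_rfl (by omega))
  refine le_trans ?_ hr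
  rcases Nat.eq_zero_or_pos a with rfl | ha <;> rcases Nat.eq_zero_or_pos b with rfl | hb <;>
    rcases Nat.eq_zero_or_pos c with rfl | hc <;> rcases Nat.eq_zero_or_pos d with rfl | hd <;>
    first
    | omega
    | try simp only [add_zero, zero_add, mul_zero, zero_mul]
  · have : max 1 b * max 1 d ≤ max 1 (b * d) := by
      rw [hmax hb, hmax hd]; exact le_max_right _ _
    simpa using this
  · have : max 1 b * max 1 c ≤ max 1 (b * c) := by
      rw [hmax hb, hmax hc]; exact le_max_right _ _
    simpa using this
  · rw [hmax hb, hmax hd, hmax hc, hmax (Nat.mul_pos hb hd),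
      hmax (Nat.mul_pos hb hc), max_eq_left zero_le_one]
    nlinarith [Nat.mul_pos (Nat.mul_pos hb hc) hd]
  · have : max 1 a * max 1 d ≤ max 1 (a * d) := by
      rw [hmax ha, hmax hd]; exact le_max_right _ _
    simpa using this
  · have : max 1 a * max 1 c ≤ max 1 (a * c) := by
      rw [hmax ha, hmax hc]; exact le_max_right _ _
    simpa using this
  · rw [hmax ha, hmax hd, hmax hc, hmax (Nat.mul_pos ha hd),
      hmax (Nat.mul_pos ha hc), max_eq_left zero_le_one]
    nlinarith [Nat.mul_pos (Nat.mul_pos ha hc) hd]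
  · rw [hmax ha, hmax hd, hmax hb, hmax (Nat.mul_pos hb hd),
      hmax (Nat.mul_pos ha hd), max_eq_left zero_le_one]
    nlinarith [Nat.mul_pos (Nat.mul_pos ha hb) hd]
  · rw [hmax ha, hmax hc, hmax hb, hmax (Nat.mul_pos hb hc),
      hmax (Nat.mul_pos ha hc), max_eq_left zero_le_one]
    nlinarith [Nat.mul_pos (Nat.mul_pos ha hb) hc]
  · rw [hmax ha, hmax hb, hmax hc, hmax hd]
    refine le_trans ?_ (Nat.mul_le_mul (le_max_right _ _) (le_max_right _ _))
    have := Nat.mul_pos ha hb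
    have := Nat.mul_pos hc hd
    have h1 : (a * b) * (c * d) ≤ (a * b) * (d * d + c * c) := by
      gcongr
      zify
      nlinarith [sq_nonneg ((c : ℤ) - d)]
    nlinarith [Nat.zero_le (a * a * (c * d)), Nat.zero_le (b * b * (c * d))]

lemma triangle_mul {x₀ x₁ x₂ x₃ y₀ y₁ y₂ y₃ : ℕ} (r s : ℕ)
    (hx₀ : x₀ ≤ x₁ + x₂ + x₃) (hx₁ : x₁ ≤ x₀ + x₂ + x₃)
    (hy₀ : y₀ ≤ y₁ + y₂ + y₃) (hy₁ : y₁ ≤ y₀ + y₂ + y₃) :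
    x₀ * y₀ + x₁ * y₁ + r ≤
      x₁ * y₀ + x₀ * y₁ + r + (x₂ * y₂ + x₃ * y₃ + s) + (x₂ * y₃ + x₃ * y₂ + s) ∧
    x₁ * y₀ + x₀ * y₁ + r ≤
      x₀ * y₀ + x₁ * y₁ + r + (x₂ * y₂ + x₃ * y₃ + s) + (x₂ * y₃ + x₃ * y₂ + s) := by
  zify at *
  have hx : |(x₀ : ℤ) - x₁| ≤ x₂ + x₃ := abs_le.2 ⟨by linarith, by linarith⟩
  have hy : |(y₀ : ℤ) - y₁| ≤ y₂ + y₃ := abs_le.2 ⟨by linarith, by linarith⟩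
  have h := mul_le_mul hx hy (abs_nonneg _) (by positivity)
  rw [← abs_mul] at h
  obtain ⟨h1, h2⟩ := abs_le.1 h
  have : (0 : ℤ) ≤ s := by positivity
  constructor <;> nlinarith

lemma mul_add_mul_add_mul_pos {a b c a' b' c' : ℕ} (h₁ : 0 < a + b) (h₂ : 0 < a + c)
    (h₃ : 0 < b + c) (h₁' : 0 < a' + b') (h₂' : 0 < a' + c') (h₃' : 0 < b' + c') :
    0 < a * a' + b * b' + c * c' := by
  have : (0 < a ∧ 0 < a') ∨ (0 < b ∧ 0 < b') ∨ (0 < c ∧ 0 < c') := by omega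
  rcases this with ⟨h, h'⟩ | ⟨h, h'⟩ | ⟨h, h'⟩ <;> have := Nat.mul_pos h h' <;> omega

/-- The invariant for the multiplication of two nets. -/
lemma mult {m e' f' y₂ y₃ E F p p' q q' : ℕ} {X₁ X₂ X₃ : ℕ} (s : ℕ)
    (h : GoodCounts n e f (p * p') x₂ x₃) (h' : GoodCounts m e' f' (q * q') y₂ y₃)
    (hp : p = 0 ↔ p' = 0) (hq : q = 0 ↔ q' = 0)
    (hE : E = e * e' + p * q) (hF : F = p' * q' + f * f')
    (hX₁ : X₁ = (p' * e' + f * q) * (e * q' + p * f'))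
    (hX₂ : X₂ = x₂ * y₂ + x₃ * y₃ + s) (hX₃ : X₃ = x₂ * y₃ + x₃ * y₂ + s) :
    GoodCounts (n + m) E F X₁ X₂ X₃ := by
  obtain ⟨r, hr⟩ : ∃ r, r = e * e' * (p' * q') + p * q * (f * f') := ⟨_, rfl⟩
  have hX₀ : E * F = e * f * (e' * f') + p * p' * (q * q') + r := by subst hE hF hr; ring
  have hX₁' : X₁ = p * p' * (e' * f') + e * f * (q * q') + r := by subst hX₁ hr; ring
  have hEle : e * e' ≤ E := by omega
  have key : e * (max 1 (e * f) * max 1 (p * p') * max 1 x₂ * max 1 x₃) *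
      (e' * (max 1 (e' * f') * max 1 (q * q') * max 1 y₂ * max 1 y₃)) ≤
      E * (max 1 (E * F) * max 1 X₁ * max 1 X₂ * max 1 X₃) := by
    have h1 := max_one_mul_le r h.pos₀₁ h'.pos₀₁
    have h2 := max_one_mul_le s h.pos₂₃ h'.pos₂₃
    rw [add_comm (x₃ * y₂)] at h2
    rw [← hX₀, ← hX₁'] at h1
    rw [← hX₂, ← hX₃] at h2
    have := Nat.mul_le_mul hEle (Nat.mul_le_mul h1 h2)
    linarith
  have hgrowth : 2 ^ (n + m + 4) ≤
      (E * (max 1 (E * F) * max 1 X₁ * max 1 X₂ * max 1 X₃)) ^ 4 := by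
    calc 2 ^ (n + m + 4) = 2 ^ (n + 2) * 2 ^ (m + 2) := by ring
      _ ≤ _ := Nat.mul_le_mul h.growth h'.growth
      _ ≤ _ := by rw [← mul_pow]; exact Nat.pow_le_pow_left key 4
  obtain ⟨g1, g2, g3, g4, g5, g6, g7, g8, g9, g10, g11, g12, -, -, -⟩ := h
  obtain ⟨k1, k2, k3, k4, k5, k6, k7, k8, k9, k10, k11, k12, -, -, -⟩ := h'
  have t01 := triangle_mul r s g8 g9 k8 k9
  have t23 := triangle_mul s r (x₀ := x₂) (x₁ := x₃) (x₂ := e * f) (x₃ := p * p')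
    (y₀ := y₂) (y₁ := y₃) (y₂ := e' * f') (y₃ := q * q')
    (by omega) (by omega) (by omega) (by omega)
  have b0 : 0 < E * F + X₂ := by
    have := mul_add_mul_add_mul_pos g2 g3 g5 k2 k3 k5
    omega
  have b1 : 0 < E * F + X₃ := by
    have := mul_add_mul_add_mul_pos g2 g3 g5 k2 k4 k6
    omega
  have b2 : 0 < X₁ + X₂ := by
    have := mul_add_mul_add_mul_pos g2 g3 g5 (by omega : 0 < q * q' + e' * f') k5 k3
    have := Nat.mul_comm (p * p') (e' * f')
    omega
  have b3 : 0 < X₁ + X₃ := by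
    have := mul_add_mul_add_mul_pos g2 g3 g5 (by omega : 0 < q * q' + e' * f') k6 k4
    omega
  have hE2 : 2 ≤ E := (k1.trans (Nat.le_mul_of_pos_left _ (by omega))).trans hEle
  have le0 : E * F ≤ X₁ + X₂ + X₃ := by omega
  refine ⟨hE2, ?_, b0, b1, b2, b3, ?_, le0, by omega, by linarith [t23.1, t23.2], by linarith [t23.1, t23.2],
    ?_, ?_, ?_, fun _ => hgrowth⟩
  · have := Nat.mul_pos g2 k2
    rw [hX₀, hX₁']
    linarith
  · have := Nat.mul_pos g7 k7
    rw [hX₂, hX₃]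
    linarith
  · rcases Nat.eq_zero_or_pos F with hF0 | hF0
    · rw [hF, Nat.add_eq_zero_iff, mul_eq_zero, mul_eq_zero] at hF0
      have base {u₀ u w₂ w₃ u₂ u₃ t a b : ℕ} (ha : a ≤ u + w₂ + w₃) (hb : b ≤ u₀)
          (hu : u₀ ≤ u₂ + u₃) (hsum : u * u₀ + (w₂ + w₃) * (u₂ + u₃) ≤ t) : a * b ≤ t :=
        calc a * b ≤ (u + w₂ + w₃) * u₀ := Nat.mul_le_mul ha hb
          _ = u * u₀ + (w₂ + w₃) * u₀ := by ring
          _ ≤ u * u₀ + (w₂ + w₃) * (u₂ + u₃) := by gcongr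
          _ ≤ t := hsum
      rcases hF0.2 with rfl | rfl
      · have hp0 : p' ≠ 0 := by rintro rfl; simp at g2
        obtain rfl : q' = 0 := hF0.1.resolve_left hp0
        obtain rfl : q = 0 := hq.2 rfl
        have hf' : 0 < f' := Nat.pos_of_ne_zero (by rintro rfl; simp at k2)
        rw [hE, mul_zero, add_zero]
        refine base g12 (Nat.le_mul_of_pos_right e' hf') (by omega) ?_
        rw [hX₁', hX₂, hX₃]
        linarith
      · have hq0 : q' ≠ 0 := by rintro rfl; simp at k2
        obtain rfl : p' = 0 := hF0.1.resolve_right hq0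
        obtain rfl : p = 0 := hp.2 rfl
        have hf : 0 < f := Nat.pos_of_ne_zero (by rintro rfl; simp at g2)
        rw [hE, zero_mul, add_zero, mul_comm]
        refine base k12 (Nat.le_mul_of_pos_right e hf) (by omega) ?_
        rw [hX₁', hX₂, hX₃]
        linarith
    · exact (Nat.le_mul_of_pos_right _ hF0).trans le0
  · right
    have hf : e * f = 0 ∨ 2 ≤ e * f := by
      rcases Nat.eq_zero_or_pos f with rfl | h0
      · simp
      · exact Or.inr (g1.trans (Nat.le_mul_of_pos_right _ h0))
    have hf' : e' * f' = 0 ∨ 2 ≤ e' * f' := by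
      rcases Nat.eq_zero_or_pos f' with rfl | h0
      · simp
      · exact Or.inr (k1.trans (Nat.le_mul_of_pos_right _ h0))
    have h23 (hx₂ : 0 < x₂) (hx₃ : 0 < x₃) (hy₂ : 0 < y₂) (hy₃ : 0 < y₃) : 2 ≤ X₂ := by
      have := Nat.mul_pos hx₂ hy₂
      have := Nat.mul_pos hx₃ hy₃
      omega
    have h10 (hx : 0 < p * p') (hy : 2 ≤ e' * f') : 2 ≤ X₁ := by
      have := hy.trans (Nat.le_mul_of_pos_left _ hx)
      omega
    have h01 (hx : 2 ≤ e * f) (hy : 0 < q * q') : 2 ≤ X₁ := by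
      have := hx.trans (Nat.le_mul_of_pos_right _ hy)
      omega
    rcases Nat.eq_zero_or_pos (p * p') with hp0 | hp0 <;>
      rcases Nat.eq_zero_or_pos (q * q') with hq0 | hq0 <;> rcases hf with hf | hf <;>
      rcases hf' with hf' | hf' <;>
      first
      | exact Or.inl (h10 hp0 hf')
      | exact Or.inl (h01 hf hq0)
      | exact Or.inr (Or.inl (h23 (by omega) (by omega) (by omega) (by omega)))
  · exact le_trans (Nat.pow_le_pow_right two_pos (by omega)) hgrowth

/-- The invariant for the incrementation of a net. -/
lemma incr {p p' : ℕ} (h : GoodCounts n e f (p * p') x₂ x₃) (hp : p = 0 ↔ p' = 0) :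
    GoodCounts (n + 2) (e + p) p' (e * (p' + f)) x₂ x₃ := by
  obtain ⟨g1, g2, g3, g4, g5, g6, g7, g8, g9, g10, g11, g12, g13, g14, g15⟩ := h
  have hX₀ : (e + p) * p' = e * p' + p * p' := by ring
  have hX₁ : e * (p' + f) = e * p' + e * f := by ring
  have hr : e * p' = 0 ↔ p' = 0 := by simp [show e ≠ 0 by omega]
  have hr1 : p' = 0 → p * p' = 0 := by rintro rfl; simp
  have hr2 : p * p' = 0 → p' = 0 := by
    intro h
    rcases mul_eq_zero.1 h with h | h
    · exact hp.1 h
    · exact h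
  have hf : e * f = 0 ∨ 2 ≤ e * f := by
    rcases Nat.eq_zero_or_pos f with rfl | h0
    · simp
    · exact Or.inr (g1.trans (Nat.le_mul_of_pos_right _ h0))
  have hr3 : e * p' = 0 ∨ 2 ≤ e * p' := by
    rcases Nat.eq_zero_or_pos p' with rfl | h0
    · simp
    · exact Or.inr (g1.trans (Nat.le_mul_of_pos_right _ h0))
  have le0 : (e + p) * p' ≤ e * (p' + f) + x₂ + x₃ := by omega
  have key : 0 < p' → 2 ^ (n + 2 + 4) ≤ ((e + p) * (max 1 ((e + p) * p') *
      max 1 (e * (p' + f)) * max 1 x₂ * max 1 x₃)) ^ 4 := by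
    intro hp'
    have hX₁pos : 1 ≤ e * (p' + f) := by omega
    have h1 : max 1 (e * f) ≤ max 1 (e * (p' + f)) := max_le_max le_rfl (by omega)
    have h2 : 2 * (e * max 1 (p * p')) ≤ (e + p) * max 1 ((e + p) * p') := by
      rw [max_eq_right (show 1 ≤ p * p' by omega), max_eq_right (show 1 ≤ (e + p) * p' by omega)]
      have : 2 * (e * p) ≤ (e + p) * (e + p) := by nlinarith
      calc 2 * (e * (p * p')) = 2 * (e * p) * p' := by ring
        _ ≤ (e + p) * (e + p) * p' := Nat.mul_le_mul_right _ this
        _ = _ := by ring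
    have h3 := Nat.mul_le_mul (Nat.mul_le_mul h2 h1) (le_refl (max 1 x₂ * max 1 x₃))
    calc 2 ^ (n + 2 + 4) = 2 ^ (n + 2) * 2 ^ 4 := by ring
      _ ≤ _ := Nat.mul_le_mul_right _ g14
      _ ≤ _ := by
        rw [← mul_pow]
        exact Nat.pow_le_pow_left (by linarith) 4
  have hp'0 : p' = 0 ∨ 0 < p' := Nat.eq_zero_or_pos p'
  refine ⟨by omega, by omega, by omega, by omega, by omega, by omega, by omega, by omega,
    by omega, by omega, by omega, ?_, by omega, ?_, key⟩
  · rcases hp'0 with rfl | h0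
    · obtain rfl := hp.2 rfl
      have hf0 : 0 < f := Nat.pos_of_ne_zero (by rintro rfl; simp at g2)
      have := Nat.le_mul_of_pos_right e hf0
      omega
    · exact (Nat.le_mul_of_pos_right _ h0).trans le0
  · rcases hp'0 with rfl | h0
    · obtain rfl := hp.2 rfl
      have hf0 : 0 < f := Nat.pos_of_ne_zero (by rintro rfl; simp at g2)
      simpa using g15 hf0
    · exact le_trans (Nat.pow_le_pow_right two_pos (by omega)) (key h0)

/-- The invariant for a cycle of length four. -/
lemma cycle : GoodCounts 4 2 1 1 1 0 := by
  constructor <;> norm_num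

/-- One of the six counts for pairs of corners is exponential in `n`. -/
lemma exists_large {a a' b b' c c' : ℕ} (h : GoodCounts n e f (a * a') (b * b') (c * c')) :
    ∃ s ∈ ({a, a', b, b', c, c'} : Finset ℕ), 2 ^ n ≤ 2 ^ 4 * s ^ 108 := by
  obtain ⟨s, hs, hmax⟩ := Finset.exists_max_image ({a, a', b, b', c, c'} : Finset ℕ) id (by simp)
  refine ⟨s, hs, ?_⟩
  simp only [id] at hmax
  have ha := Nat.mul_le_mul (hmax a (by simp)) (hmax a' (by simp))
  have hb := Nat.mul_le_mul (hmax b (by simp)) (hmax b' (by simp))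
  have hc := Nat.mul_le_mul (hmax c (by simp)) (hmax c' (by simp))
  have hs0 : 0 < s := by
    rcases Nat.eq_zero_or_pos s with rfl | hs0
    · have := h.pos₁₂
      omega
    · exact hs0
  rcases h.four_or with rfl | h2
  · exact Nat.le_mul_of_pos_right _ (Nat.pow_pos hs0)
  · have hs2 : 2 ≤ s := by
      by_contra! hlt
      obtain rfl : s = 1 := by omega
      omega
    have hss : 1 ≤ s * s := Nat.mul_pos hs0 hs0
    have h0 := h.le₀
    have he := h.le_sum
    have h13 : 2 ^ 13 ≤ s ^ 13 := Nat.pow_le_pow_left hs2 13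
    calc 2 ^ n ≤ 2 ^ (n + 2) := Nat.pow_le_pow_right two_pos (by omega)
      _ ≤ _ := h.growth
      _ ≤ (3 * (s * s) * (3 * (s * s) * (s * s) * (s * s) * (s * s))) ^ 4 := by
        gcongr <;> omega
      _ = 6561 * s ^ 40 := by ring
      _ ≤ s ^ 13 * s ^ 40 := by gcongr; omega
      _ = s ^ 53 := by ring
      _ ≤ s ^ 108 := Nat.pow_le_pow_right hs0 (by norm_num)
      _ ≤ 2 ^ 4 * s ^ 108 := by omega

end GoodCounts

/-- The number of matchings of `G[A]` covering exactly the vertices of `A \ X`. -/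
noncomputable def nearPMCount (G : SimpleGraph V) (A X : Set V) : ℕ :=
  {M : Set (Sym2 V) | IsNearPM G A X M}.ncard

/-- `N` is a perfect matching between `Y₁` and `Y₂` in `G`. -/
def IsCrossMatching (G : SimpleGraph V) (Y₁ Y₂ : Set V) (N : Set (Sym2 V)) : Prop :=
  (∀ e ∈ N, ∃ x y, e = s(x, y) ∧ G.Adj x y ∧ x ∈ Y₁ ∧ y ∈ Y₂) ∧
  ∀ w ∈ Y₁ ∪ Y₂, ∃! e, e ∈ N ∧ w ∈ e

section Join

variable {G : SimpleGraph V} {A₁ A₂ X₁ X₂ Y₁ Y₂ Y₁' Y₂' : Set V} {M₁ M₂ N N' : Set (Sym2 V)}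

lemma isCrossMatching_empty : IsCrossMatching G ∅ ∅ ∅ := by
  simp [IsCrossMatching]

lemma isCrossMatching_singleton {u v : V} (h : G.Adj u v) :
    IsCrossMatching G {u} {v} {s(u, v)} := by
  refine ⟨fun e he => ⟨u, v, he, h, rfl, rfl⟩, fun w hw => ⟨s(u, v), ⟨rfl, ?_⟩, fun e he => he.1⟩⟩
  simpa [or_comm, eq_comm] using hw

lemma isCrossMatching_pair {u u' v v' : V} (h : G.Adj u v) (h' : G.Adj u' v') (hu : u ≠ u')
    (hv : v ≠ v') (huv' : u ≠ v') (hu'v : u' ≠ v) :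
    IsCrossMatching G {u, u'} {v, v'} {s(u, v), s(u', v')} := by
  refine ⟨?_, ?_⟩
  · rintro e (rfl | rfl)
    · exact ⟨u, v, rfl, h, by simp, by simp⟩
    · exact ⟨u', v', rfl, h', by simp, by simp⟩
  · rintro w ((rfl | rfl) | (rfl | rfl))
    · refine ⟨s(w, v), by simp, ?_⟩
      rintro e ⟨rfl | rfl, he⟩
      · rfl
      · simp only [Sym2.mem_iff] at he
        grind
    · refine ⟨s(w, v'), by simp, ?_⟩
      rintro e ⟨rfl | rfl, he⟩
      · simp only [Sym2.mem_iff] at he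
        grind
      · rfl
    · refine ⟨s(u, w), by simp, ?_⟩
      rintro e ⟨rfl | rfl, he⟩
      · rfl
      · simp only [Sym2.mem_iff] at he
        grind
    · refine ⟨s(u', w), by simp, ?_⟩
      rintro e ⟨rfl | rfl, he⟩
      · simp only [Sym2.mem_iff] at he
        grind
      · rfl

lemma IsNearPM.mem_of_mem {A X : Set V} {M : Set (Sym2 V)} (h : IsNearPM G A X M) {e : Sym2 V}
    (he : e ∈ M) {w : V} (hw : w ∈ e) : w ∈ A := by
  obtain ⟨x, y, rfl, -, hx, hy⟩ := h.1 e he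
  rcases Sym2.mem_iff.1 hw with rfl | rfl <;> assumption

lemma IsCrossMatching.mem_of_mem (h : IsCrossMatching G Y₁ Y₂ N) {e : Sym2 V}
    (he : e ∈ N) {w : V} (hw : w ∈ e) : w ∈ Y₁ ∪ Y₂ := by
  obtain ⟨x, y, rfl, -, hx, hy⟩ := h.1 e he
  rcases Sym2.mem_iff.1 hw with rfl | rfl
  exacts [Or.inl hx, Or.inr hy]

lemma IsNearPM.join (hA : Disjoint A₁ A₂) (hX₁ : X₁ ⊆ A₁) (hX₂ : X₂ ⊆ A₂)
    (hY₁ : Y₁ ⊆ A₁ \ X₁) (hY₂ : Y₂ ⊆ A₂ \ X₂) (hN : IsCrossMatching G Y₁ Y₂ N)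
    (h₁ : IsNearPM G A₁ (X₁ ∪ Y₁) M₁) (h₂ : IsNearPM G A₂ (X₂ ∪ Y₂) M₂) :
    IsNearPM G (A₁ ∪ A₂) (X₁ ∪ X₂) (M₁ ∪ M₂ ∪ N) := by
  have hd {w : V} (hw₁ : w ∈ A₁) (hw₂ : w ∈ A₂) : False := Set.disjoint_left.1 hA hw₁ hw₂
  refine ⟨?_, ?_, ?_⟩
  · rintro e ((he | he) | he)
    · obtain ⟨x, y, rfl, h, hx, hy⟩ := h₁.1 e he
      exact ⟨x, y, rfl, h, Or.inl hx, Or.inl hy⟩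
    · obtain ⟨x, y, rfl, h, hx, hy⟩ := h₂.1 e he
      exact ⟨x, y, rfl, h, Or.inr hx, Or.inr hy⟩
    · obtain ⟨x, y, rfl, h, hx, hy⟩ := hN.1 e he
      exact ⟨x, y, rfl, h, Or.inl (hY₁ hx).1, Or.inr (hY₂ hy).1⟩
  · rintro w ⟨hw, hwX⟩
    rw [Set.mem_union, not_or] at hwX
    by_cases hwY : w ∈ Y₁ ∪ Y₂
    · obtain ⟨e, he, huniq⟩ := hN.2 w hwY
      refine ⟨e, ⟨Or.inr he.1, he.2⟩, ?_⟩
      rintro e' ⟨(he' | he') | he', hwe'⟩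
      · have hwA := h₁.mem_of_mem he' hwe'
        rcases hwY with hwY | hwY
        · exact absurd hwe' (h₁.2.2 w (Or.inr hwY) e' he')
        · exact (hd hwA (hY₂ hwY).1).elim
      · have hwA := h₂.mem_of_mem he' hwe'
        rcases hwY with hwY | hwY
        · exact (hd (hY₁ hwY).1 hwA).elim
        · exact absurd hwe' (h₂.2.2 w (Or.inr hwY) e' he')
      · exact huniq e' ⟨he', hwe'⟩
    · have hwY' : w ∉ Y₁ ∧ w ∉ Y₂ := not_or.1 hwY
      rcases hw with hw | hw
      · obtain ⟨e, he, huniq⟩ := h₁.2.1 w ⟨hw, not_or.2 ⟨hwX.1, hwY'.1⟩⟩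
        refine ⟨e, ⟨Or.inl (Or.inl he.1), he.2⟩, ?_⟩
        rintro e' ⟨(he' | he') | he', hwe'⟩
        · exact huniq e' ⟨he', hwe'⟩
        · exact (hd hw (h₂.mem_of_mem he' hwe')).elim
        · exact absurd (hN.mem_of_mem he' hwe') hwY
      · obtain ⟨e, he, huniq⟩ := h₂.2.1 w ⟨hw, not_or.2 ⟨hwX.2, hwY'.2⟩⟩
        refine ⟨e, ⟨Or.inl (Or.inr he.1), he.2⟩, ?_⟩
        rintro e' ⟨(he' | he') | he', hwe'⟩
        · exact (hd (h₁.mem_of_mem he' hwe') hw).elim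
        · exact huniq e' ⟨he', hwe'⟩
        · exact absurd (hN.mem_of_mem he' hwe') hwY
  · rintro w hw e ((he | he) | he) hwe
    · rcases hw with hw | hw
      · exact h₁.2.2 w (Or.inl hw) e he hwe
      · exact hd (h₁.mem_of_mem he hwe) (hX₂ hw)
    · rcases hw with hw | hw
      · exact hd (hX₁ hw) (h₂.mem_of_mem he hwe)
      · exact h₂.2.2 w (Or.inl hw) e he hwe
    · rcases hN.mem_of_mem he hwe with hY | hY <;> rcases hw with hw | hw
      · exact (hY₁ hY).2 hw
      · exact hd (hY₁ hY).1 (hX₂ hw)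
      · exact hd (hX₁ hw) (hY₂ hY).1
      · exact (hY₂ hY).2 hw

/-- The three parts of a joined matching are determined by the matching. -/
lemma IsNearPM.join_parts {Z₁ Z₂ : Set V} (hA : Disjoint A₁ A₂)
    (hY₁ : Y₁ ⊆ A₁) (hY₂ : Y₂ ⊆ A₂) (hN : IsCrossMatching G Y₁ Y₂ N)
    (h₁ : IsNearPM G A₁ Z₁ M₁) (h₂ : IsNearPM G A₂ Z₂ M₂) :
    M₁ = {e ∈ M₁ ∪ M₂ ∪ N | ∀ w ∈ e, w ∈ A₁} ∧ M₂ = {e ∈ M₁ ∪ M₂ ∪ N | ∀ w ∈ e, w ∈ A₂} ∧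
      N = {e ∈ M₁ ∪ M₂ ∪ N | (∃ w ∈ e, w ∉ A₁) ∧ ∃ w ∈ e, w ∉ A₂} := by
  have hd {w : V} (hw₁ : w ∈ A₁) (hw₂ : w ∈ A₂) : False := Set.disjoint_left.1 hA hw₁ hw₂
  have hM₁ e (he : e ∈ M₁) : (∀ w ∈ e, w ∈ A₁) ∧ ∃ w ∈ e, w ∉ A₂ := by
    obtain ⟨x, y, rfl, -, hx, hy⟩ := h₁.1 e he
    exact ⟨fun w hw => h₁.mem_of_mem he hw, x, by simp, fun hx' => hd hx hx'⟩
  have hM₂ e (he : e ∈ M₂) : (∀ w ∈ e, w ∈ A₂) ∧ ∃ w ∈ e, w ∉ A₁ := by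
    obtain ⟨x, y, rfl, -, hx, hy⟩ := h₂.1 e he
    exact ⟨fun w hw => h₂.mem_of_mem he hw, x, by simp, fun hx' => hd hx' hx⟩
  have hN' e (he : e ∈ N) : (∃ w ∈ e, w ∉ A₁) ∧ ∃ w ∈ e, w ∉ A₂ := by
    obtain ⟨x, y, rfl, -, hx, hy⟩ := hN.1 e he
    exact ⟨⟨y, by simp, fun h => hd h (hY₂ hy)⟩, x, by simp, fun h => hd (hY₁ hx) h⟩
  refine ⟨?_, ?_, ?_⟩ <;> ext e <;> simp only [Set.mem_union, Set.mem_ofPred_eq] <;>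
    have := hM₁ e <;> have := hM₂ e <;> have := hN' e <;> grind

lemma exists_join_family (hA : Disjoint A₁ A₂) (hX₁ : X₁ ⊆ A₁) (hX₂ : X₂ ⊆ A₂)
    (hY₁ : Y₁ ⊆ A₁ \ X₁) (hY₂ : Y₂ ⊆ A₂ \ X₂) (hN : IsCrossMatching G Y₁ Y₂ N) :
    ∃ F ⊆ {M | IsNearPM G (A₁ ∪ A₂) (X₁ ∪ X₂) M},
      F.ncard = nearPMCount G A₁ (X₁ ∪ Y₁) * nearPMCount G A₂ (X₂ ∪ Y₂) ∧
      ∀ M ∈ F, N = {e ∈ M | (∃ w ∈ e, w ∉ A₁) ∧ ∃ w ∈ e, w ∉ A₂} := by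
  have hY₁' := hY₁.trans Set.sdiff_subset
  have hY₂' := hY₂.trans Set.sdiff_subset
  refine ⟨(fun M : Set (Sym2 V) × Set (Sym2 V) => M.1 ∪ M.2 ∪ N) ''
    ({M | IsNearPM G A₁ (X₁ ∪ Y₁) M} ×ˢ {M | IsNearPM G A₂ (X₂ ∪ Y₂) M}), ?_, ?_, ?_⟩
  · rintro _ ⟨⟨M₁, M₂⟩, ⟨h₁, h₂⟩, rfl⟩
    exact IsNearPM.join hA hX₁ hX₂ hY₁ hY₂ hN h₁ h₂
  · rw [Set.InjOn.ncard_image, Set.ncard_prod]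
    · rfl
    · rintro ⟨M₁, M₂⟩ ⟨h₁, h₂⟩ ⟨M₁', M₂'⟩ ⟨h₁', h₂'⟩ heq
      have p := IsNearPM.join_parts hA hY₁' hY₂' hN h₁ h₂
      have p' := IsNearPM.join_parts hA hY₁' hY₂' hN h₁' h₂'
      simp only at heq
      rw [heq] at p
      exact Prod.ext (p.1.trans p'.1.symm) (p.2.1.trans p'.2.1.symm)
  · rintro _ ⟨⟨M₁, M₂⟩, ⟨h₁, h₂⟩, rfl⟩
    exact (IsNearPM.join_parts hA hY₁' hY₂' hN h₁ h₂).2.2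

variable [Finite V]

lemma mul_le_nearPMCount (hA : Disjoint A₁ A₂) (hX₁ : X₁ ⊆ A₁) (hX₂ : X₂ ⊆ A₂)
    (hY₁ : Y₁ ⊆ A₁ \ X₁) (hY₂ : Y₂ ⊆ A₂ \ X₂) (hN : IsCrossMatching G Y₁ Y₂ N) :
    nearPMCount G A₁ (X₁ ∪ Y₁) * nearPMCount G A₂ (X₂ ∪ Y₂) ≤
      nearPMCount G (A₁ ∪ A₂) (X₁ ∪ X₂) := by
  obtain ⟨F, hF, hcard, -⟩ := exists_join_family hA hX₁ hX₂ hY₁ hY₂ hN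
  rw [← hcard]
  exact Set.ncard_le_ncard hF (Set.toFinite _)

lemma add_mul_le_nearPMCount (hA : Disjoint A₁ A₂) (hX₁ : X₁ ⊆ A₁) (hX₂ : X₂ ⊆ A₂)
    (hY₁ : Y₁ ⊆ A₁ \ X₁) (hY₂ : Y₂ ⊆ A₂ \ X₂) (hN : IsCrossMatching G Y₁ Y₂ N)
    (hY₁' : Y₁' ⊆ A₁ \ X₁) (hY₂' : Y₂' ⊆ A₂ \ X₂) (hN' : IsCrossMatching G Y₁' Y₂' N')
    (hne : N ≠ N') :
    nearPMCount G A₁ (X₁ ∪ Y₁) * nearPMCount G A₂ (X₂ ∪ Y₂) +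
      nearPMCount G A₁ (X₁ ∪ Y₁') * nearPMCount G A₂ (X₂ ∪ Y₂') ≤
      nearPMCount G (A₁ ∪ A₂) (X₁ ∪ X₂) := by
  obtain ⟨F, hF, hcard, hFN⟩ := exists_join_family hA hX₁ hX₂ hY₁ hY₂ hN
  obtain ⟨F', hF', hcard', hFN'⟩ := exists_join_family hA hX₁ hX₂ hY₁' hY₂' hN'
  rw [← hcard, ← hcard', ← Set.ncard_union_eq ?_ (Set.toFinite _) (Set.toFinite _)]
  · exact Set.ncard_le_ncard (Set.union_subset hF hF') (Set.toFinite _)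
  · exact Set.disjoint_left.2 fun M hM hM' => hne ((hFN M hM).trans (hFN' M hM').symm)

end Join

/-- Lower bounds on the matching counts of the net `G[st]` with corners `a`, `b`, `c`, `d`,
satisfying the invariant of `GoodCounts`. -/
structure NetProfile (G : SimpleGraph V) (st : Set V) (a b c d : V)
    (e f ab cd ac bd ad bc : ℕ) : Prop where
  hab : a ≠ b
  hac : a ≠ c
  had : a ≠ d
  hbc : b ≠ c
  hbd : b ≠ d
  hcd : c ≠ d
  ha : a ∈ st
  hb : b ∈ st
  hc : c ∈ st
  hd : d ∈ st
  le_e : e ≤ nearPMCount G st ∅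
  le_f : f ≤ nearPMCount G st {a, b, c, d}
  le_ab : ab ≤ nearPMCount G st {a, b}
  le_cd : cd ≤ nearPMCount G st {c, d}
  le_ac : ac ≤ nearPMCount G st {a, c}
  le_bd : bd ≤ nearPMCount G st {b, d}
  le_ad : ad ≤ nearPMCount G st {a, d}
  le_bc : bc ≤ nearPMCount G st {b, c}
  iff_ab : ab = 0 ↔ cd = 0
  iff_ac : ac = 0 ↔ bd = 0
  iff_ad : ad = 0 ↔ bc = 0
  good : GoodCounts st.ncard e f (ab * cd) (ac * bd) (ad * bc)

/-- Some profile exists for the net `G[st]` with corners `a`, `b`, `c`, `d`. -/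
def HasNetProfile (G : SimpleGraph V) (st : Set V) (a b c d : V) : Prop :=
  ∃ e f ab cd ac bd ad bc, NetProfile G st a b c d e f ab cd ac bd ad bc

namespace HasNetProfile

variable {G : SimpleGraph V} {st : Set V} {a b c d : V}

lemma swap_ab (h : HasNetProfile G st a b c d) : HasNetProfile G st b a c d := by
  obtain ⟨e, f, ab, cd, ac, bd, ad, bc, h⟩ := h
  refine ⟨e, f, ab, cd, bc, ad, bd, ac, h.hab.symm, h.hbc, h.hbd, h.hac, h.had, h.hcd, h.hb, h.ha,
    h.hc, h.hd, h.le_e, ?_, ?_, h.le_cd, h.le_bc, h.le_ad, h.le_bd, h.le_ac, h.iff_ab,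
    h.iff_ad.symm, h.iff_ac.symm, ?_⟩
  · rw [Set.insert_comm]
    exact h.le_f
  · rw [Set.pair_comm]
    exact h.le_ab
  · rw [mul_comm bc, mul_comm bd]
    exact h.good.swap₂₃

lemma swap_bc (h : HasNetProfile G st a b c d) : HasNetProfile G st a c b d := by
  obtain ⟨e, f, ab, cd, ac, bd, ad, bc, h⟩ := h
  refine ⟨e, f, ac, bd, ab, cd, ad, bc, h.hac, h.hab, h.had, h.hbc.symm, h.hcd, h.hbd, h.ha, h.hc,
    h.hb, h.hd, h.le_e, ?_, h.le_ac, h.le_bd, h.le_ab, h.le_cd, h.le_ad, ?_, h.iff_ac,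
    h.iff_ab, h.iff_ad, h.good.swap₁₂⟩
  · rw [Set.insert_comm c]
    exact h.le_f
  · rw [Set.pair_comm]
    exact h.le_bc

lemma swap_cd (h : HasNetProfile G st a b c d) : HasNetProfile G st a b d c := by
  obtain ⟨e, f, ab, cd, ac, bd, ad, bc, h⟩ := h
  refine ⟨e, f, ab, cd, ad, bc, ac, bd, h.hab, h.had, h.hac, h.hbd, h.hbc, h.hcd.symm, h.ha, h.hb,
    h.hd, h.hc, h.le_e, ?_, h.le_ab, ?_, h.le_ad, h.le_bc, h.le_ac, h.le_bd, h.iff_ab,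
    h.iff_ad, h.iff_ac, h.good.swap₂₃⟩
  · rw [Set.pair_comm d]
    exact h.le_f
  · rw [Set.pair_comm]
    exact h.le_cd

/-- Any two corners can be brought to the front of the enumeration of the corners. -/
lemma exists_front (h : HasNetProfile G st a b c d) {u u' : V} (hu : u ∈ ({a, b, c, d} : Set V))
    (hu' : u' ∈ ({a, b, c, d} : Set V)) (hne : u ≠ u') :
    ∃ w w', HasNetProfile G st u u' w w' ∧ ({a, b, c, d} : Set V) \ {u, u'} = {w, w'} := by
  have key : ∃ w w', HasNetProfile G st u u' w w' ∧
      ({a, b, c, d} : Set V) = {u, u', w, w'} := by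
    rcases hu with rfl | rfl | rfl | rfl <;> rcases hu' with rfl | rfl | rfl | rfl <;>
      first
      | exact absurd rfl hne
      | refine ⟨_, _, h, ?_⟩
        grind
      | refine ⟨_, _, h.swap_ab, ?_⟩
        grind
      | refine ⟨_, _, h.swap_bc, ?_⟩
        grind
      | refine ⟨_, _, h.swap_bc.swap_ab, ?_⟩
        grind
      | refine ⟨_, _, h.swap_ab.swap_bc, ?_⟩
        grind
      | refine ⟨_, _, h.swap_ab.swap_bc.swap_ab, ?_⟩
        grind
      | refine ⟨_, _, h.swap_cd.swap_bc, ?_⟩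
        grind
      | refine ⟨_, _, h.swap_cd.swap_bc.swap_ab, ?_⟩
        grind
      | refine ⟨_, _, h.swap_ab.swap_cd.swap_bc, ?_⟩
        grind
      | refine ⟨_, _, h.swap_ab.swap_cd.swap_bc.swap_ab, ?_⟩
        grind
      | refine ⟨_, _, h.swap_bc.swap_ab.swap_cd.swap_bc, ?_⟩
        grind
      | refine ⟨_, _, h.swap_bc.swap_ab.swap_cd.swap_bc.swap_ab, ?_⟩
        grind
  obtain ⟨w, w', hw, hset⟩ := key
  refine ⟨w, w', hw, ?_⟩
  obtain ⟨_, _, _, _, _, _, _, _, hw⟩ := hw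
  rw [hset]
  ext x
  have := hw.hac
  have := hw.had
  have := hw.hbc
  have := hw.hbd
  simp only [Set.mem_sdiff, Set.mem_insert_iff, Set.mem_singleton_iff]
  grind

end HasNetProfile

/-- The disjoint vertex sets `A₁` and `A₂` are linked by the two disjoint edges `uv` and `u'v'`. -/
structure DoubleLink (G : SimpleGraph V) (A₁ A₂ : Set V) (u u' v v' : V) : Prop where
  disj : Disjoint A₁ A₂
  hu : u ∈ A₁
  hu' : u' ∈ A₁
  hv : v ∈ A₂
  hv' : v' ∈ A₂
  huu' : u ≠ u'
  hvv' : v ≠ v'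
  adj : G.Adj u v
  adj' : G.Adj u' v'

namespace DoubleLink

variable {G : SimpleGraph V} {A₁ A₂ X₁ X₂ Z₁ Z₂ Z₁' Z₂' Z : Set V} {u u' v v' : V}

lemma ne (h : DoubleLink G A₁ A₂ u u' v v') {x y : V} (hx : x ∈ A₁) (hy : y ∈ A₂) : x ≠ y :=
  fun hxy => Set.disjoint_left.1 h.disj hx (hxy ▸ hy)

lemma swap (h : DoubleLink G A₁ A₂ u u' v v') : DoubleLink G A₁ A₂ u' u v' v :=
  ⟨h.disj, h.hu', h.hu, h.hv', h.hv, h.huu'.symm, h.hvv'.symm, h.adj', h.adj⟩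

variable [Finite V]

lemma none_le (h : DoubleLink G A₁ A₂ u u' v v') (hX₁ : X₁ ⊆ A₁) (hX₂ : X₂ ⊆ A₂)
    (hZ : X₁ ∪ X₂ = Z) :
    nearPMCount G A₁ X₁ * nearPMCount G A₂ X₂ ≤ nearPMCount G (A₁ ∪ A₂) Z := by
  have := mul_le_nearPMCount (G := G) (Y₁ := ∅) (Y₂ := ∅) h.disj hX₁ hX₂ (Set.empty_subset _)
    (Set.empty_subset _) isCrossMatching_empty
  rwa [Set.union_empty, Set.union_empty, hZ] at this

lemma one_le (h : DoubleLink G A₁ A₂ u u' v v') (hX₁ : X₁ ⊆ A₁ \ {u}) (hX₂ : X₂ ⊆ A₂ \ {v})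
    (hZ₁ : X₁ ∪ {u} = Z₁) (hZ₂ : X₂ ∪ {v} = Z₂) (hZ : X₁ ∪ X₂ = Z) :
    nearPMCount G A₁ Z₁ * nearPMCount G A₂ Z₂ ≤ nearPMCount G (A₁ ∪ A₂) Z := by
  have hu := h.hu
  have hv := h.hv
  subst hZ₁ hZ₂ hZ
  exact mul_le_nearPMCount h.disj (by grind) (by grind) (by grind) (by grind)
    (isCrossMatching_singleton h.adj)

lemma none_add_both_le (h : DoubleLink G A₁ A₂ u u' v v') (hX₁ : X₁ ⊆ A₁ \ {u, u'})
    (hX₂ : X₂ ⊆ A₂ \ {v, v'}) (hZ₁ : X₁ ∪ {u, u'} = Z₁) (hZ₂ : X₂ ∪ {v, v'} = Z₂)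
    (hZ : X₁ ∪ X₂ = Z) :
    nearPMCount G A₁ X₁ * nearPMCount G A₂ X₂ + nearPMCount G A₁ Z₁ * nearPMCount G A₂ Z₂ ≤
      nearPMCount G (A₁ ∪ A₂) Z := by
  have hu := h.hu
  have hv := h.hv
  have hu' := h.hu'
  have hv' := h.hv'
  subst hZ₁ hZ₂ hZ
  have := add_mul_le_nearPMCount (G := G) (X₁ := X₁) (X₂ := X₂) (Y₁ := ∅) (Y₂ := ∅) h.disj
    (by grind) (by grind) (by grind) (by grind) isCrossMatching_empty (by grind) (by grind)
    (isCrossMatching_pair h.adj h.adj' h.huu' h.hvv' (h.ne hu hv') (h.ne hu' hv))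
    (Set.insert_nonempty _ _).ne_empty.symm
  rwa [Set.union_empty, Set.union_empty] at this

lemma one_add_one_le (h : DoubleLink G A₁ A₂ u u' v v') (hX₁ : X₁ ⊆ A₁ \ {u, u'})
    (hX₂ : X₂ ⊆ A₂ \ {v, v'}) (hZ₁ : X₁ ∪ {u} = Z₁) (hZ₂ : X₂ ∪ {v} = Z₂)
    (hZ₁' : X₁ ∪ {u'} = Z₁') (hZ₂' : X₂ ∪ {v'} = Z₂') (hZ : X₁ ∪ X₂ = Z) :
    nearPMCount G A₁ Z₁ * nearPMCount G A₂ Z₂ + nearPMCount G A₁ Z₁' * nearPMCount G A₂ Z₂' ≤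
      nearPMCount G (A₁ ∪ A₂) Z := by
  have hu := h.hu
  have hv := h.hv
  have hu' := h.hu'
  have hv' := h.hv'
  have huu' := h.huu'
  have huv' := h.ne hu hv'
  subst hZ₁ hZ₂ hZ₁' hZ₂' hZ
  refine add_mul_le_nearPMCount h.disj (by grind) (by grind) (by grind) (by grind)
    (isCrossMatching_singleton h.adj) (by grind) (by grind) (isCrossMatching_singleton h.adj') ?_
  intro heq
  have := Set.singleton_eq_singleton_iff.1 heq
  grind

end DoubleLink

lemma one_le_nearPMCount_self [Finite V] (G : SimpleGraph V) (A : Set V) :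
    1 ≤ nearPMCount G A A :=
  (Set.ncard_pos (Set.toFinite _)).2 ⟨∅, by simp [IsNearPM]⟩

lemma one_le_nearPMCount_edge [Finite V] {G : SimpleGraph V} {a b : V} (h : G.Adj a b) :
    1 ≤ nearPMCount G {a, b} ∅ := by
  refine (Set.ncard_pos (Set.toFinite _)).2 ⟨{s(a, b)}, ?_, ?_, ?_⟩
  · rintro e rfl
    exact ⟨a, b, rfl, h, by simp, by simp⟩
  · rintro w ⟨hw, -⟩
    exact ⟨s(a, b), ⟨rfl, by simpa using hw⟩, fun e he => he.1⟩
  · simp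

namespace HasNetProfile

variable [Finite V] {G : SimpleGraph V}

lemma cyc4 {a b c d : V} (hab : G.Adj a b) (hcd : G.Adj c d)
    (h : DoubleLink G {a, b} {c, d} a b d c) : HasNetProfile G ({a, b} ∪ {c, d}) a b c d := by
  have hac : a ≠ c := h.ne (by simp) (by simp)
  have had : a ≠ d := h.ne (by simp) (by simp)
  have hbc : b ≠ c := h.ne (by simp) (by simp)
  have hbd : b ≠ d := h.ne (by simp) (by simp)
  have hab' := hab.ne
  have hcd' := hcd.ne
  have e₁ := one_le_nearPMCount_edge hab
  have e₂ := one_le_nearPMCount_edge hcd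
  have s₁ := one_le_nearPMCount_self G {a, b}
  have s₂ := one_le_nearPMCount_self G {c, d}
  refine ⟨2, 1, 1, 1, 0, 0, 1, 1, hab', hac, had, hbc, hbd, hcd', by simp, by simp, by simp,
    by simp, ?_, ?_, ?_, ?_, Nat.zero_le _, Nat.zero_le _, ?_, ?_, by simp, by simp, by simp, ?_⟩
  · exact (add_le_add (Nat.mul_le_mul e₁ e₂) (Nat.mul_le_mul s₁ s₂)).trans
      (h.none_add_both_le (Set.empty_subset _) (Set.empty_subset _) (by grind) (by grind)
        (by grind))
  · exact (Nat.mul_le_mul s₁ s₂).trans (h.none_le (by grind) (by grind) (by grind))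
  · exact (Nat.mul_le_mul s₁ e₂).trans (h.none_le (by grind) (by grind) (by grind))
  · exact (Nat.mul_le_mul e₁ s₂).trans (h.none_le (by grind) (by grind) (by grind))
  · exact (Nat.mul_le_mul s₁ s₂).trans
      (h.swap.one_le (X₁ := {a}) (X₂ := {d}) (by grind) (by grind) (by grind) (by grind)
        (by grind))
  · exact (Nat.mul_le_mul s₁ s₂).trans
      (h.one_le (X₁ := {b}) (X₂ := {c}) (by grind) (by grind) (by grind) (by grind) (by grind))
  · have : ({a, b} ∪ {c, d} : Set V).ncard = 4 := by
      rw [Set.ncard_union_eq h.disj, Set.ncard_pair hab', Set.ncard_pair hcd']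
    rw [this]
    exact GoodCounts.cycle.swap₂₃

lemma incr {st : Set V} {u u' w w' v v' : V} (h : HasNetProfile G st u u' w w')
    (hvv' : G.Adj v v') (hl : DoubleLink G st {v, v'} u u' v v') :
    HasNetProfile G (st ∪ {v, v'}) v v' w w' := by
  obtain ⟨e, f, p, p', ac, bd, ad, bc, h⟩ := h
  have hE := one_le_nearPMCount_edge hvv'
  have hS := one_le_nearPMCount_self G {v, v'}
  have hv := hl.hv
  have hv' := hl.hv'
  have hvw := hl.ne h.hc hv
  have hv'w := hl.ne h.hc hv'
  have hvw' := hl.ne h.hd hv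
  have hv'w' := hl.ne h.hd hv'
  have hab := h.hab
  have hac := h.hac
  have had := h.had
  have hbc := h.hbc
  have hbd := h.hbd
  have hcd := h.hcd
  have hu := h.ha
  have hu' := h.hb
  have hw := h.hc
  have hw' := h.hd
  have hne := hvv'.ne
  refine ⟨e + p, p', e, p' + f, bc, ad, bd, ac, hne, hvw.symm, hvw'.symm, hv'w.symm, hv'w'.symm,
    hcd, by simp, by simp, Or.inl hw, Or.inl hw', ?_, ?_, ?_, ?_, ?_, ?_, ?_, ?_, ?_,
    h.iff_ad.symm, h.iff_ac.symm, ?_⟩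
  · calc e + p = e * 1 + p * 1 := by ring
      _ ≤ _ := add_le_add (Nat.mul_le_mul h.le_e hE) (Nat.mul_le_mul h.le_ab hS)
      _ ≤ _ := hl.none_add_both_le (by grind) (by grind) (by grind) (by grind) (by grind)
  · calc p' = p' * 1 := by ring
      _ ≤ _ := Nat.mul_le_mul h.le_cd hS
      _ ≤ _ := hl.none_le (by grind) (by grind) (by grind)
  · calc e = e * 1 := by ring
      _ ≤ _ := Nat.mul_le_mul h.le_e hS
      _ ≤ _ := hl.none_le (by grind) (by grind) (by grind)
  · calc p' + f = p' * 1 + f * 1 := by ring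
      _ ≤ _ := add_le_add (Nat.mul_le_mul h.le_cd hE) (Nat.mul_le_mul h.le_f hS)
      _ ≤ _ := hl.none_add_both_le (by grind) (by grind) (by grind) (by grind) (by grind)
  · calc bc = bc * 1 := by ring
      _ ≤ _ := Nat.mul_le_mul h.le_bc hS
      _ ≤ _ := hl.swap.one_le (X₁ := {w}) (X₂ := {v}) (by grind) (by grind) (by grind)
        (by grind) (by grind)
  · calc ad = ad * 1 := by ring
      _ ≤ _ := Nat.mul_le_mul h.le_ad hS
      _ ≤ _ := hl.one_le (X₁ := {w'}) (X₂ := {v'}) (by grind) (by grind) (by grind)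
        (by grind) (by grind)
  · calc bd = bd * 1 := by ring
      _ ≤ _ := Nat.mul_le_mul h.le_bd hS
      _ ≤ _ := hl.swap.one_le (X₁ := {w'}) (X₂ := {v}) (by grind) (by grind) (by grind)
        (by grind) (by grind)
  · calc ac = ac * 1 := by ring
      _ ≤ _ := Nat.mul_le_mul h.le_ac hS
      _ ≤ _ := hl.one_le (X₁ := {w}) (X₂ := {v'}) (by grind) (by grind) (by grind)
        (by grind) (by grind)
  · have h2 := h.good.two_le
    have h3 := h.good.pos₀₁
    have : ¬(p' = 0 ∧ f = 0) := by
      rintro ⟨rfl, rfl⟩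
      simp at h3
    omega
  · rw [Set.ncard_union_eq hl.disj, Set.ncard_pair hne, mul_comm bc, mul_comm bd]
    exact (h.good.incr h.iff_ab).swap₂₃

lemma mult {st₁ st₂ : Set V} {u u' w w' v v' z z' : V} (h : HasNetProfile G st₁ u u' w w')
    (k : HasNetProfile G st₂ v v' z z') (hl : DoubleLink G st₁ st₂ u u' v v') :
    HasNetProfile G (st₁ ∪ st₂) w w' z z' := by
  obtain ⟨e, f, p, p', ac, bd, ad, bc, h⟩ := h
  obtain ⟨e₂, f₂, q, q', ac₂, bd₂, ad₂, bc₂, k⟩ := k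
  have hwz := hl.ne h.hc k.hc
  have hwz' := hl.ne h.hc k.hd
  have hw'z := hl.ne h.hd k.hc
  have hw'z' := hl.ne h.hd k.hd
  have hab := h.hab
  have hac := h.hac
  have had := h.had
  have hbc := h.hbc
  have hbd := h.hbd
  have hcd := h.hcd
  have hu := h.ha
  have hu' := h.hb
  have hw := h.hc
  have hw' := h.hd
  have kab := k.hab
  have kac := k.hac
  have kad := k.had
  have kbc := k.hbc
  have kbd := k.hbd
  have kcd := k.hcd
  have kv := k.ha
  have kv' := k.hb
  have kz := k.hc
  have kz' := k.hd
  refine ⟨e * e₂ + p * q, p' * q' + f * f₂, p' * e₂ + f * q, e * q' + p * f₂,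
    ac * ac₂ + bc * bc₂, ad * ad₂ + bd * bd₂, ac * ad₂ + bc * bd₂, ad * ac₂ + bd * bc₂,
    hcd, hwz, hwz', hw'z, hw'z', kcd, Or.inl hw, Or.inl hw', Or.inr kz, Or.inr kz',
    ?_, ?_, ?_, ?_, ?_, ?_, ?_, ?_, ?_, ?_, ?_, ?_⟩
  · exact (add_le_add (Nat.mul_le_mul h.le_e k.le_e) (Nat.mul_le_mul h.le_ab k.le_ab)).trans
      (hl.none_add_both_le (X₁ := ∅) (X₂ := ∅) (by grind) (by grind) (by grind)
        (by grind) (by grind))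
  · exact (add_le_add (Nat.mul_le_mul h.le_cd k.le_cd) (Nat.mul_le_mul h.le_f k.le_f)).trans
      (hl.none_add_both_le (X₁ := {w, w'}) (X₂ := {z, z'}) (by grind) (by grind) (by grind)
        (by grind) (by grind))
  · exact (add_le_add (Nat.mul_le_mul h.le_cd k.le_e) (Nat.mul_le_mul h.le_f k.le_ab)).trans
      (hl.none_add_both_le (X₁ := {w, w'}) (X₂ := ∅) (by grind) (by grind) (by grind)
        (by grind) (by grind))
  · exact (add_le_add (Nat.mul_le_mul h.le_e k.le_cd) (Nat.mul_le_mul h.le_ab k.le_f)).trans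
      (hl.none_add_both_le (X₁ := ∅) (X₂ := {z, z'}) (by grind) (by grind) (by grind)
        (by grind) (by grind))
  · exact (add_le_add (Nat.mul_le_mul h.le_ac k.le_ac) (Nat.mul_le_mul h.le_bc k.le_bc)).trans
      (hl.one_add_one_le (X₁ := {w}) (X₂ := {z}) (by grind) (by grind) (by grind) (by grind)
        (by grind) (by grind) (by grind))
  · exact (add_le_add (Nat.mul_le_mul h.le_ad k.le_ad) (Nat.mul_le_mul h.le_bd k.le_bd)).trans
      (hl.one_add_one_le (X₁ := {w'}) (X₂ := {z'}) (by grind) (by grind) (by grind) (by grind)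
        (by grind) (by grind) (by grind))
  · exact (add_le_add (Nat.mul_le_mul h.le_ac k.le_ad) (Nat.mul_le_mul h.le_bc k.le_bd)).trans
      (hl.one_add_one_le (X₁ := {w}) (X₂ := {z'}) (by grind) (by grind) (by grind) (by grind)
        (by grind) (by grind) (by grind))
  · exact (add_le_add (Nat.mul_le_mul h.le_ad k.le_ac) (Nat.mul_le_mul h.le_bd k.le_bc)).trans
      (hl.one_add_one_le (X₁ := {w'}) (X₂ := {z}) (by grind) (by grind) (by grind) (by grind)
        (by grind) (by grind) (by grind))
  · have h2 := h.good.two_le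
    have h3 := h.good.pos₀₁
    have k2 := k.good.two_le
    have k3 := k.good.pos₀₁
    have hf : p' = 0 → f ≠ 0 := by
      rintro rfl rfl
      simp at h3
    have hf₂ : q' = 0 → f₂ ≠ 0 := by
      rintro rfl rfl
      simp at k3
    have he : e ≠ 0 := by omega
    have he₂ : e₂ ≠ 0 := by omega
    simp only [Nat.add_eq_zero_iff, mul_eq_zero, he, he₂, h.iff_ab, k.iff_ab]
    clear * - hf hf₂
    tauto
  · simp only [Nat.add_eq_zero_iff, mul_eq_zero, h.iff_ac, k.iff_ac, h.iff_ad, k.iff_ad]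
    exact and_comm
  · simp only [Nat.add_eq_zero_iff, mul_eq_zero, h.iff_ac, k.iff_ac, h.iff_ad, k.iff_ad]
    exact and_comm
  · rw [Set.ncard_union_eq hl.disj]
    exact h.good.mult (ac * ac₂ * (ad * ad₂) + bc * bc₂ * (bd * bd₂)) k.good h.iff_ab k.iff_ab
      rfl rfl rfl (by ring) (by ring)

end HasNetProfile

lemma IsTwistedNet.exists_hasNetProfile [Finite V] {G : SimpleGraph V} {st C : Set V}
    (h : IsTwistedNet G st C) : ∃ a b c d, C = {a, b, c, d} ∧ HasNetProfile G st a b c d := by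
  induction h with
  | cyc4 a b c d hab hac had hbc hbd hcd hadj =>
    refine ⟨a, b, c, d, rfl, ?_⟩
    have adj x (hx : x ∈ ({a, b, c, d} : Set V)) y (hy : y ∈ ({a, b, c, d} : Set V))
        (h : s(x, y) ∈ ({s(a, b), s(b, c), s(c, d), s(d, a)} : Set (Sym2 V))) : G.Adj x y :=
      (hadj x hx y hy).2 h
    have h1 : G.Adj a b := adj a (by simp) b (by simp) (by simp)
    have h2 : G.Adj b c := adj b (by simp) c (by simp) (by simp)
    have h3 : G.Adj c d := adj c (by simp) d (by simp) (by simp)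
    have h4 : G.Adj d a := adj d (by simp) a (by simp) (by simp)
    clear hadj adj
    have hset : ({a, b, c, d} : Set V) = {a, b} ∪ {c, d} := by grind
    rw [hset]
    exact HasNetProfile.cyc4 h1 h3
      ⟨Set.disjoint_left.2 (by grind), by simp, by simp, by simp, by simp, hab, hcd.symm,
        h4.symm, h2⟩
  | incr st C u u' v v' hprev hu hu' huu' hv hv' hvv' hadj huv hu'v' hcross ih =>
    clear hcross
    obtain ⟨a, b, c, d, rfl, ih⟩ := ih
    obtain ⟨w, w', h, hset⟩ := ih.exists_front hu hu' huu'
    have hst : u ∈ st ∧ u' ∈ st := by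
      obtain ⟨_, _, _, _, _, _, _, _, h⟩ := h
      exact ⟨h.ha, h.hb⟩
    refine ⟨v, v', w, w', ?_, h.incr hadj
      ⟨Set.disjoint_left.2 (by grind), hst.1, hst.2, by simp, by simp, huu', hvv', huv, hu'v'⟩⟩
    rw [hset]
    grind
  | mult st₁ C₁ st₂ C₂ u u' v v' h₁ h₂ hdisj hu hu' huu' hv hv' hvv' huv hu'v' hcross ih₁ ih₂ =>
    clear hcross
    obtain ⟨a, b, c, d, rfl, ih₁⟩ := ih₁
    obtain ⟨a₂, b₂, c₂, d₂, rfl, ih₂⟩ := ih₂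
    obtain ⟨w, w', h, hset⟩ := ih₁.exists_front hu hu' huu'
    obtain ⟨z, z', k, kset⟩ := ih₂.exists_front hv hv' hvv'
    have hst : u ∈ st₁ ∧ u' ∈ st₁ := by
      obtain ⟨_, _, _, _, _, _, _, _, h⟩ := h
      exact ⟨h.ha, h.hb⟩
    have kst : v ∈ st₂ ∧ v' ∈ st₂ := by
      obtain ⟨_, _, _, _, _, _, _, _, h⟩ := k
      exact ⟨h.ha, h.hb⟩
    refine ⟨w, w', z, z', ?_, h.mult k
      ⟨Set.disjoint_iff_inter_eq_empty.2 hdisj, hst.1, hst.2, kst.1, kst.2, huu', hvv', huv,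
        hu'v'⟩⟩
    rw [hset, kset]
    grind

lemma rpow_le_of_two_pow_le {n s t : ℕ} (h : 2 ^ n ≤ 2 ^ 4 * s ^ 108) (hst : s ≤ t) :
    (2 : ℝ) ^ ((n : ℝ) / 108 - 1 / 27) ≤ t := by
  have h1 : ((2 : ℝ) ^ ((n : ℝ) / 108 - 1 / 27)) ^ 108 ≤ (t : ℝ) ^ 108 := by
    rw [← Real.rpow_natCast, ← Real.rpow_mul two_pos.le,
      show ((n : ℝ) / 108 - 1 / 27) * (108 : ℕ) = n - (4 : ℕ) by push_cast; ring,
      Real.rpow_sub two_pos, Real.rpow_natCast, Real.rpow_natCast, div_le_iff₀' (by positivity)]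
    exact_mod_cast h.trans (Nat.mul_le_mul_left _ (Nat.pow_le_pow_left hst 108))
  exact le_of_pow_le_pow_left₀ (by norm_num) (Nat.cast_nonneg t) h1

/-- For every twisted net `G` with `n` vertices there exist two corners `u, v` such
that `G \ {u, v}` has at least `2^(n/108 - 1/27)` perfect matchings. -/
theorem twisted_net_two_corners_many_matchings
    [Fintype V] (G : SimpleGraph V) (c : Set V)
    (h : IsTwistedNet G Set.univ c) :
    ∃ u ∈ c, ∃ v ∈ c, u ≠ v ∧
      (2 : ℝ) ^ ((Fintype.card V : ℝ) / 108 - 1 / 27) ≤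
        ({M : Set (Sym2 V) | IsNearPM G Set.univ {u, v} M}.ncard : ℝ) := by
  obtain ⟨x, y, z, w, rfl, e, f, ab, cd, ac, bd, ad, bc, hp⟩ := h.exists_hasNetProfile
  obtain ⟨s, hs, hlarge⟩ := hp.good.exists_large
  rw [Set.ncard_univ, Nat.card_eq_fintype_card] at hlarge
  simp only [Finset.mem_insert, Finset.mem_singleton] at hs
  rcases hs with rfl | rfl | rfl | rfl | rfl | rfl
  · exact ⟨x, by simp, y, by simp, hp.hab, rpow_le_of_two_pow_le hlarge hp.le_ab⟩
  · exact ⟨z, by simp, w, by simp, hp.hcd, rpow_le_of_two_pow_le hlarge hp.le_cd⟩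
  · exact ⟨x, by simp, z, by simp, hp.hac, rpow_le_of_two_pow_le hlarge hp.le_ac⟩
  · exact ⟨y, by simp, w, by simp, hp.hbd, rpow_le_of_two_pow_le hlarge hp.le_bd⟩
  · exact ⟨x, by simp, w, by simp, hp.had, rpow_le_of_two_pow_le hlarge hp.le_ad⟩
  · exact ⟨y, by simp, z, by simp, hp.hbc, rpow_le_of_two_pow_le hlarge hp.le_bc⟩
end
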